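/- (Isoperimetric inequality for H².) Let K be a compact geodesically convex subset of the hyperbolic plane H² (of constant curvature −1) with nonempty interior. Then P_K² ≥ A_K·(4π + A_K), with equality if and only if K is a closed hyperbolic disc. -/

import Mathlib

open MeasureTheory Metric Real UpperHalfPlane

open scoped UpperHalfPlane

noncomputable section

instance : MeasurableSpace ℍ := borel ℍ

instance : BorelSpace ℍ := ⟨rfl⟩

/-- The hyperbolic area measure on the upper half-plane: the measure with density
`y⁻²` with respect to the planar Lebesgue measure. -/
def hypAreaMeasure : Measure ℍ :=
  (Measure.comap (fun z : ℍ => (z : ℂ)) volume).withDensity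
    (fun z => ENNReal.ofReal ((z.im ^ 2)⁻¹))

/-- The hyperbolic area of a subset of the hyperbolic plane. -/
def hypArea (K : Set ℍ) : ℝ := (hypAreaMeasure K).toReal

/-- The hyperbolic perimeter: one-dimensional Hausdorff measure (with respect to the
hyperbolic metric) of the topological boundary. -/
def hypPerim (K : Set ℍ) : ℝ := (μH[1] (frontier K)).toReal

/-- Geodesic convexity in the hyperbolic plane. -/
def HypConvex (K : Set ℍ) : Prop :=
  ∀ x ∈ K, ∀ y ∈ K, ∀ z : ℍ, dist x z + dist z y = dist x y → z ∈ K

/-- The hyperbolic circumradius of `K`. -/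
def hypCircumradius (K : Set ℍ) : ℝ :=
  sInf {R : ℝ | ∃ c : ℍ, K ⊆ Metric.closedBall c R}

/-- The hyperbolic inradius of `K`. -/
def hypInradius (K : Set ℍ) : ℝ :=
  sSup {r : ℝ | ∃ c : ℍ, Metric.closedBall c r ⊆ K}

/-- `K` is a closed hyperbolic disc of positive radius. -/
def IsHypDisc (K : Set ℍ) : Prop :=
  ∃ (c : ℍ) (r : ℝ), 0 < r ∧ K = Metric.closedBall c r

end

namespace HypIso
open Set Filter Topology
lemma continuousOn_of_convexOn_of_lsc {x1 x2 : ℝ} {g : ℝ → ℝ} (hg : ConvexOn ℝ (Icc x1 x2) g)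
    (hl : LowerSemicontinuousOn g (Icc x1 x2)) : ContinuousOn g (Icc x1 x2) := by
  rw [continuousOn_iff_lower_upperSemicontinuousOn]
  refine ⟨hl, ?_⟩
  have key : ∀ x ∈ Icc x1 x2, ∀ e ∈ Icc x1 x2, UpperSemicontinuousWithinAt g (segment ℝ x e) x := by
    intro x hx e he
    by_cases hxe : x = e
    · subst hxe
      intro y hy
      simp only [segment_same, nhdsWithin_singleton]
      simpa using hy
    intro y hy
    have hne : e - x ≠ 0 := sub_ne_zero.mpr (Ne.symm hxe)
    have ht : Tendsto (fun z => g x + (z - x) / (e - x) * (g e - g x)) (𝓝[segment ℝ x e] x) (𝓝 (g x)) := by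
      have : Continuous (fun z => g x + (z - x) / (e - x) * (g e - g x)) := by fun_prop
      have h2 := this.tendsto x
      simp only [sub_self, zero_div, zero_mul, add_zero] at h2
      exact h2.mono_left nhdsWithin_le_nhds
    filter_upwards [ht.eventually_lt_const hy, self_mem_nhdsWithin] with z hz hzs
    obtain ⟨a, b, ha, hb, hab, rfl⟩ := hzs
    have h3 := hg.2 hx he ha hb hab
    have : (a • x + b • e - x) / (e - x) = b := by
      simp only [smul_eq_mul]
      rw [div_eq_iff hne]
      have : a = 1 - b := by linarith
      subst this; ring
    rw [this] at hz
    refine lt_of_le_of_lt h3 (lt_of_eq_of_lt ?_ hz)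
    have : a = 1 - b := by linarith
    subst this; simp only [smul_eq_mul]; ring
  intro x hx
  have h1 := key x hx x1 ⟨le_rfl, hx.1.trans hx.2⟩
  have h2 := key x hx x2 ⟨hx.1.trans hx.2, le_rfl⟩
  rw [segment_symm, segment_eq_Icc hx.1] at h1
  rw [segment_eq_Icc hx.2] at h2
  intro y hy
  rw [← Icc_union_Icc_eq_Icc hx.1 hx.2, nhdsWithin_union]
  exact eventually_sup.mpr ⟨h1 y hy, h2 y hy⟩

/-- Lower boundary function of a compact convex planar set. -/
lemma lower_fun (S : Set (ℝ × ℝ)) (hc : IsCompact S) (hcv : Convex ℝ S) {x1 x2 : ℝ}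
    (hI : Prod.fst '' S = Icc x1 x2) :
    ∃ g : ℝ → ℝ, ContinuousOn g (Icc x1 x2) ∧ ConvexOn ℝ (Icc x1 x2) g ∧
      (∀ x ∈ Icc x1 x2, (x, g x) ∈ S) ∧ (∀ p ∈ S, g p.1 ≤ p.2) := by
  have hex : ∀ x ∈ Icc x1 x2, ∃ w, (x, w) ∈ S ∧ ∀ w', (x, w') ∈ S → w ≤ w' := by
    intro x hx
    have hcl : IsCompact {w | (x, w) ∈ S} := by
      have : {w | (x, w) ∈ S} = Prod.snd '' (S ∩ (Prod.fst ⁻¹' {x})) := by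
        ext w
        simp
      rw [this]
      exact (hc.inter_right (isClosed_singleton.preimage continuous_fst)).image continuous_snd
    have hne : {w | (x, w) ∈ S}.Nonempty := by
      rw [← hI] at hx
      obtain ⟨⟨a, b⟩, h, rfl⟩ := hx
      exact ⟨b, h⟩
    obtain ⟨w, hw, hw2⟩ := hcl.exists_isLeast hne
    exact ⟨w, hw, fun w' h => hw2 h⟩
  choose! g hg hg2 using hex
  have hfst : ∀ p ∈ S, p.1 ∈ Icc x1 x2 := fun p hp => hI ▸ mem_image_of_mem _ hp
  have hconv : ConvexOn ℝ (Icc x1 x2) g := by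
    refine ⟨convex_Icc _ _, fun x hx y hy a b ha hb hab => ?_⟩
    have := hcv (hg x hx) (hg y hy) ha hb hab
    exact hg2 _ (convex_Icc x1 x2 hx hy ha hb hab) _ this
  refine ⟨g, ?_, hconv, hg, fun p hp => hg2 _ (hfst p hp) _ hp⟩
  apply continuousOn_of_convexOn_of_lsc hconv
  rw [lowerSemicontinuousOn_iff_preimage_Iic]
  intro r
  refine ⟨Prod.fst '' (S ∩ Prod.snd ⁻¹' (Iic r)), ?_, ?_⟩
  · exact ((hc.inter_right (isClosed_Iic.preimage continuous_snd)).image continuous_fst).isClosed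
  · ext x
    constructor
    · rintro ⟨hx, hx2⟩
      exact ⟨hx, (x, g x), ⟨hg x hx, hx2⟩, rfl⟩
    · rintro ⟨hx, ⟨a, b⟩, ⟨h1, h2⟩, rfl⟩
      exact ⟨hx, (hg2 _ hx _ h1).trans h2⟩

theorem convex_slices (S : Set (ℝ × ℝ)) (hc : IsCompact S) (hcv : Convex ℝ S)
    (hint : (interior S).Nonempty) : ∃ (x1 x2 : ℝ) (g1 g2 : ℝ → ℝ), x1 < x2 ∧
      ContinuousOn g1 (Icc x1 x2) ∧ ContinuousOn g2 (Icc x1 x2) ∧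
      ConvexOn ℝ (Icc x1 x2) g1 ∧ ConcaveOn ℝ (Icc x1 x2) g2 ∧
      (∀ x ∈ Icc x1 x2, g1 x ≤ g2 x) ∧ (∀ x ∈ Ioo x1 x2, g1 x < g2 x) ∧
      (∀ x w : ℝ, (x, w) ∈ S ↔ x ∈ Icc x1 x2 ∧ g1 x ≤ w ∧ w ≤ g2 x) := by
  obtain ⟨⟨u, v⟩, huv⟩ := hint
  have hSne : S.Nonempty := ⟨_, interior_subset huv⟩
  obtain ⟨x1, x2, hI⟩ : ∃ x1 x2, Prod.fst '' S = Icc x1 x2 := by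
    have h1 : IsCompact (Prod.fst '' S) := hc.image continuous_fst
    have h2 : IsConnected (Prod.fst '' S) :=
      (hcv.isConnected hSne).image _ continuous_fst.continuousOn
    exact ⟨_, _, eq_Icc_of_connected_compact h2 h1⟩
  obtain ⟨g1, hg1c, hg1v, hg1m, hg1l⟩ := lower_fun S hc hcv hI
  let R : ℝ × ℝ →L[ℝ] ℝ × ℝ := (ContinuousLinearMap.fst ℝ ℝ ℝ).prod (-(ContinuousLinearMap.snd ℝ ℝ ℝ))
  have hR : ∀ p, R p = (p.1, -p.2) := fun p => rfl
  obtain ⟨g2, hg2c, hg2v, hg2m, hg2l⟩ := lower_fun (R '' S) (hc.image R.continuous)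
    (hcv.linear_image R.toLinearMap) (x1 := x1) (x2 := x2) (by
      rw [← hI, image_image]; rfl)
  have hg2l' : ∀ p ∈ S, p.2 ≤ - g2 p.1 := fun p hp => by
    have := hg2l _ (mem_image_of_mem R hp)
    simp only [hR] at this
    linarith
  have hg2m' : ∀ x ∈ Icc x1 x2, (x, - g2 x) ∈ S := fun x hx => by
    obtain ⟨⟨a, b⟩, h, h2⟩ := hg2m x hx
    simp only [hR, Prod.mk.injEq] at h2
    obtain ⟨rfl, h3⟩ := h2
    rw [← h3, neg_neg]; exact h
  have hle : ∀ x ∈ Icc x1 x2, g1 x ≤ - g2 x := fun x hx => hg1l _ (hg2m' x hx)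
  have hfst : ∀ p ∈ S, p.1 ∈ Icc x1 x2 := fun p hp => hI ▸ mem_image_of_mem _ hp
  -- interior point
  obtain ⟨ε, hε, hball⟩ := Metric.isOpen_iff.mp isOpen_interior _ huv
  have hin : ∀ p q : ℝ, |p| < ε → |q| < ε → (u + p, v + q) ∈ S := by
    intro p q hp hq
    apply interior_subset; apply hball
    rw [Metric.mem_ball, Prod.dist_eq]
    simpa [Real.dist_eq] using ⟨hp, hq⟩
  have he : |ε / 2| < ε := by rw [abs_of_pos (by positivity)]; linarith
  have he' : |-(ε / 2)| < ε := by rw [abs_neg]; exact he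
  have h0 : |(0:ℝ)| < ε := by simpa using hε
  have hu1 := (hfst _ (hin _ _ he' h0)).1
  have hu2 := (hfst _ (hin _ _ he h0)).2
  have hv1 := hg1l _ (hin _ _ h0 h0)
  have hv2 := hg2l' _ (hin _ _ h0 he)
  simp only [add_zero] at hu1 hu2 hv1 hv2
  refine ⟨x1, x2, g1, fun x => - g2 x, by linarith, hg1c, hg2c.neg, hg1v, hg2v.neg, hle, ?_, ?_⟩
  · intro x hx
    have hcv2 : ConvexOn ℝ (Icc x1 x2) (g1 + g2) := hg1v.add hg2v
    have hneg : ∀ y ∈ Icc x1 x2, (g1 + g2) y ≤ 0 := fun y hy => by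
      have := hle y hy; simp only [Pi.add_apply]; linarith
    have hu : u ∈ Icc x1 x2 := ⟨by linarith, by linarith⟩
    have hune : (g1 + g2) u < 0 := by simp only [Pi.add_apply]; linarith
    suffices h : (g1 + g2) x < 0 by simp only [Pi.add_apply] at h; linarith
    have hseg : ∀ e ∈ Icc x1 x2, x ∈ segment ℝ u e → x ≠ e → (g1 + g2) x < 0 := by
      rintro e he ⟨a, b, ha, hb, hab, rfl⟩ hxe
      have hapos : 0 < a := by
        rcases ha.lt_or_eq with h | h
        · exact h
        · exfalso; apply hxe; subst h; simp at hab; simp [hab]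
      refine lt_of_le_of_lt (hcv2.2 hu he ha hb hab) ?_
      have := hneg e he
      simp only [smul_eq_mul]
      nlinarith
    rcases le_total u x with h | h
    · refine hseg x2 ⟨by linarith, le_rfl⟩ ?_ hx.2.ne
      rw [segment_eq_Icc (by linarith)]; exact ⟨h, hx.2.le⟩
    · refine hseg x1 ⟨le_rfl, by linarith⟩ ?_ hx.1.ne'
      rw [segment_symm, segment_eq_Icc (by linarith)]; exact ⟨hx.1.le, h⟩
  · intro x w
    constructor
    · intro h
      exact ⟨hfst _ h, hg1l _ h, hg2l' _ h⟩
    · rintro ⟨hx, h1, h2⟩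
      have hs : w ∈ segment ℝ (g1 x) (- g2 x) := by
        rw [segment_eq_Icc (hle x hx)]; exact ⟨h1, h2⟩
      obtain ⟨a, b, ha, hb, hab, rfl⟩ := hs
      have := hcv (hg1m x hx) (hg2m' x hx) ha hb hab
      convert this using 1
      ext
      · simp only [Prod.fst_add, Prod.smul_fst]; rw [← add_smul, hab, one_smul]
      · simp

end HypIso

namespace HypIso
open Set Filter Topology
noncomputable def hh (a b y : ℝ) : ℝ := √((b - y) * (y - a))

noncomputable def HH (a b y : ℝ) : ℝ := ∫ u in a..y, hh a b u / ((b - a) / 2 * u)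

lemma hh_cont (a b : ℝ) : Continuous (hh a b) := by unfold hh; fun_prop

lemma hh_nonneg (a b y : ℝ) : 0 ≤ hh a b y := Real.sqrt_nonneg _

lemma hh_sq {a b y : ℝ} (h1 : a ≤ y) (h2 : y ≤ b) :
    hh a b y ^ 2 = ((b - a) / 2) ^ 2 - (y - (a + b) / 2) ^ 2 := by
  unfold hh
  rw [Real.sq_sqrt (mul_nonneg (by linarith) (by linarith))]
  ring

lemma HH_int {a b : ℝ} (hab : a < b) {u v : ℝ} (hu : 0 < u) (hv : 0 < v) :
    IntervalIntegrable (fun u => hh a b u / ((b - a) / 2 * u)) MeasureTheory.volume u v := by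
  apply ContinuousOn.intervalIntegrable
  apply ContinuousOn.div (hh_cont a b).continuousOn (by fun_prop)
  intro x hx
  have : 0 < x := lt_of_lt_of_le (lt_min hu hv) hx.1
  have : 0 < b - a := by linarith
  positivity

lemma HH_deriv {a b : ℝ} (ha : 0 < a) (hab : a < b) {y : ℝ} (hy : 0 < y) :
    HasDerivAt (HH a b) (hh a b y / ((b - a) / 2 * y)) y := by
  have hba : 0 < b - a := by linarith
  have hcont : ContinuousOn (fun u => hh a b u / ((b - a) / 2 * u)) (Ioi 0) := by
    apply ContinuousOn.div (hh_cont a b).continuousOn (by fun_prop)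
    intro x hx
    have : 0 < x := hx
    positivity
  apply intervalIntegral.integral_hasDerivAt_right (HH_int hab ha hy)
  · exact hcont.stronglyMeasurableAtFilter isOpen_Ioi y hy
  · exact hcont.continuousAt (Ioi_mem_nhds hy)

lemma HH_a (a b : ℝ) : HH a b a = 0 := by simp [HH]

/-- value of the total integral -/
lemma HH_b {a b : ℝ} (ha : 0 < a) (hab : a < b) :
    (b - a) / 2 * HH a b b = Real.pi * ((a + b) / 2 - √(a * b)) := by
  have hba : 0 < b - a := by linarith
  have hb : 0 < b := by linarith
  set c := (a + b) / 2 with hc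
  set ρ := (b - a) / 2 with hρ
  have hρ0 : 0 < ρ := by positivity
  set q := √(a * b) with hq
  have hq0 : 0 < q := Real.sqrt_pos.mpr (mul_pos ha hb)
  have hq2 : q ^ 2 = a * b := Real.sq_sqrt (mul_pos ha hb).le
  let F : ℝ → ℝ := fun y => hh a b y + c * Real.arcsin ((y - c) / ρ)
    - q * Real.arcsin ((c * y - q ^ 2) / (ρ * y))
  have hFc : ContinuousOn F (Icc a b) := by
    apply ContinuousOn.sub
    · apply ContinuousOn.add (hh_cont a b).continuousOn
      apply ContinuousOn.mul continuousOn_const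
      exact (Real.continuous_arcsin.comp (by fun_prop)).continuousOn
    · apply ContinuousOn.mul continuousOn_const
      apply Real.continuous_arcsin.comp_continuousOn
      apply ContinuousOn.div (by fun_prop) (by fun_prop)
      intro x hx
      have : 0 < x := lt_of_lt_of_le ha hx.1
      positivity
  have hFd : ∀ y ∈ Ioo a b, HasDerivAt F (hh a b y / y) y := by
    intro y hy
    have hy0 : 0 < y := ha.trans hy.1
    have hpos : 0 < (b - y) * (y - a) := mul_pos (by linarith [hy.2]) (by linarith [hy.1])
    have hh0 : 0 < hh a b y := Real.sqrt_pos.mpr hpos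
    have hh2 : hh a b y ^ 2 = (b - y) * (y - a) := Real.sq_sqrt hpos.le
    have d1 : HasDerivAt (hh a b) ((c - y) / hh a b y) y := by
      have : HasDerivAt (fun y => (b - y) * (y - a)) ((-1) * (y - a) + (b - y) * 1) y := by
        apply HasDerivAt.mul
        · simpa using (hasDerivAt_id y).const_sub b
        · simpa using (hasDerivAt_id y).sub_const a
      have := this.sqrt hpos.ne'
      refine HasDerivAt.congr_deriv this ?_
      symm
      simp only [hh, hc]
      have := Real.sqrt_pos.mpr hpos
      field_simp
      ring
    have e1 : √(1 - ((y - c) / ρ) ^ 2) = hh a b y / ρ := by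
      rw [Real.sqrt_eq_iff_mul_self_eq_of_pos (by positivity)]
      field_simp
      rw [hh2]; simp only [hc, hρ]; ring
    have e2 : √(1 - ((c * y - q ^ 2) / (ρ * y)) ^ 2) = q * hh a b y / (ρ * y) := by
      rw [Real.sqrt_eq_iff_mul_self_eq_of_pos (by positivity)]
      field_simp
      rw [hh2, hq2]; simp only [hc, hρ]; ring
    have ne1 : ∀ z : ℝ, √(1 - z ^ 2) ≠ 0 → z ≠ -1 ∧ z ≠ 1 := by
      intro z hz
      constructor <;> rintro rfl <;> simp at hz
    have n1 := ne1 ((y - c) / ρ) (by rw [e1]; positivity)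
    have n2 := ne1 ((c * y - q ^ 2) / (ρ * y)) (by rw [e2]; positivity)
    have d2 : HasDerivAt (fun y => Real.arcsin ((y - c) / ρ)) (1 / hh a b y) y := by
      have h1 : HasDerivAt (fun y => (y - c) / ρ) (1 / ρ) y := by
        simpa using ((hasDerivAt_id y).sub_const c).div_const ρ
      have := (Real.hasDerivAt_arcsin n1.1 n1.2).comp y h1
      refine HasDerivAt.congr_deriv this ?_
      symm
      rw [e1]; field_simp
    have d3 : HasDerivAt (fun y => Real.arcsin ((c * y - q ^ 2) / (ρ * y))) (q / (y * hh a b y)) y := by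
      have h1 : HasDerivAt (fun y => (c * y - q ^ 2) / (ρ * y))
          ((c * (ρ * y) - (c * y - q ^ 2) * ρ) / (ρ * y) ^ 2) y := by
        apply HasDerivAt.div
        · simpa using ((hasDerivAt_id y).const_mul c).sub_const (q ^ 2)
        · simpa using (hasDerivAt_id y).const_mul ρ
        · positivity
      have := (Real.hasDerivAt_arcsin n2.1 n2.2).comp y h1
      refine HasDerivAt.congr_deriv this ?_
      symm
      rw [e2]; field_simp; ring
    have := (d1.add (d2.const_mul c)).sub (d3.const_mul q)
    refine HasDerivAt.congr_deriv this ?_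
    symm
    have : hh a b y / y = hh a b y ^ 2 / (y * hh a b y) := by field_simp
    rw [this, hh2]
    field_simp
    rw [hq2]; simp only [hc]; ring
  have hint : IntervalIntegrable (fun y => hh a b y / y) MeasureTheory.volume a b := by
    apply ContinuousOn.intervalIntegrable
    apply ContinuousOn.div (hh_cont a b).continuousOn (by fun_prop)
    intro x hx
    rw [uIcc_of_le hab.le] at hx
    exact (lt_of_lt_of_le ha hx.1).ne'
  have hI := intervalIntegral.integral_eq_sub_of_hasDerivAt_of_le hab.le hFc hFd hint
  have hHH : ρ * HH a b b = ∫ y in a..b, hh a b y / y := by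
    unfold HH
    rw [← intervalIntegral.integral_const_mul]
    congr 1; ext y
    rw [← hρ]; field_simp
  rw [hHH, hI]
  have v1 : (b - c) / ρ = 1 := by rw [div_eq_one_iff_eq hρ0.ne']; simp only [hc, hρ]; ring
  have v2 : (a - c) / ρ = -1 := by rw [div_eq_iff hρ0.ne']; simp only [hc, hρ]; ring
  have v3 : (c * b - q ^ 2) / (ρ * b) = 1 := by
    rw [div_eq_one_iff_eq (by positivity), hq2]; simp only [hc, hρ]; ring
  have v4 : (c * a - q ^ 2) / (ρ * a) = -1 := by
    rw [div_eq_iff (by positivity), hq2]; simp only [hc, hρ]; ring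
  simp only [F, v1, v2, v3, v4, Real.arcsin_one, Real.arcsin_neg_one]
  simp only [hh, sub_self, zero_mul, mul_zero, Real.sqrt_zero]
  ring

/-- value of the disc area integral -/
lemma disc_int {c ρ : ℝ} (hρ : 0 < ρ) (hc : ρ < c) :
    ∫ x in (-ρ)..ρ, ((c - √(ρ ^ 2 - x ^ 2))⁻¹ - (c + √(ρ ^ 2 - x ^ 2))⁻¹)
      = 2 * Real.pi * (c / √(c ^ 2 - ρ ^ 2) - 1) := by
  have hq' : 0 < c ^ 2 - ρ ^ 2 := by nlinarith
  set q := √(c ^ 2 - ρ ^ 2) with hq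
  have hq0 : 0 < q := Real.sqrt_pos.mpr hq'
  have hq2 : q ^ 2 = c ^ 2 - ρ ^ 2 := Real.sq_sqrt hq'.le
  have hc0 : 0 < c := by linarith
  let F : ℝ → ℝ := fun x => 2 * (c / q * Real.arcsin (c * x / (ρ * √(q ^ 2 + x ^ 2)))
    - Real.arcsin (x / ρ))
  have hqx : ∀ x : ℝ, 0 < q ^ 2 + x ^ 2 := fun x => by positivity
  have hFc : Continuous F := by
    apply Continuous.mul continuous_const
    apply Continuous.sub
    · apply Continuous.mul continuous_const
      apply Real.continuous_arcsin.comp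
      apply Continuous.div (by fun_prop) (by fun_prop)
      intro x
      have := Real.sqrt_pos.mpr (hqx x)
      positivity
    · exact Real.continuous_arcsin.comp (by fun_prop)
  have hsle : ∀ x : ℝ, √(ρ ^ 2 - x ^ 2) ≤ ρ := fun x => by
    rw [Real.sqrt_le_left hρ.le]; nlinarith [sq_nonneg x]
  have hFd : ∀ x ∈ Ioo (-ρ) ρ, HasDerivAt F
      ((c - √(ρ ^ 2 - x ^ 2))⁻¹ - (c + √(ρ ^ 2 - x ^ 2))⁻¹) x := by
    intro x hx
    have hpos : 0 < ρ ^ 2 - x ^ 2 := by nlinarith [hx.1, hx.2]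
    have hle := hsle x
    set s := √(ρ ^ 2 - x ^ 2) with hs
    have hs0 : 0 < s := Real.sqrt_pos.mpr hpos
    have hs2 : s ^ 2 = ρ ^ 2 - x ^ 2 := Real.sq_sqrt hpos.le
    have ht0 := Real.sqrt_pos.mpr (hqx x)
    have ht2 := Real.sq_sqrt (hqx x).le
    have e1 : √(1 - (x / ρ) ^ 2) = s / ρ := by
      rw [Real.sqrt_eq_iff_mul_self_eq_of_pos (by positivity)]
      field_simp
      rw [hs2]
    have dt : HasDerivAt (fun x => √(q ^ 2 + x ^ 2)) (x / √(q ^ 2 + x ^ 2)) x := by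
      have : HasDerivAt (fun x => q ^ 2 + x ^ 2) (2 * x) x := by
        simpa using (hasDerivAt_pow 2 x).const_add (q ^ 2)
      have := this.sqrt (hqx x).ne'
      refine HasDerivAt.congr_deriv this ?_
      symm
      field_simp
    set t := √(q ^ 2 + x ^ 2) with ht
    have e2 : √(1 - (c * x / (ρ * t)) ^ 2) = q * s / (ρ * t) := by
      rw [Real.sqrt_eq_iff_mul_self_eq_of_pos (by positivity)]
      field_simp
      rw [hs2, ht2, hq2]; ring
    have ne1 : ∀ z : ℝ, √(1 - z ^ 2) ≠ 0 → z ≠ -1 ∧ z ≠ 1 := by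
      intro z hz
      constructor <;> rintro rfl <;> simp at hz
    have n1 := ne1 (x / ρ) (by rw [e1]; positivity)
    have n2 := ne1 (c * x / (ρ * t)) (by rw [e2]; positivity)
    have d2 : HasDerivAt (fun y => Real.arcsin (y / ρ)) (1 / s) x := by
      have h1 : HasDerivAt (fun y => y / ρ) (1 / ρ) x := by
        simpa using (hasDerivAt_id x).div_const ρ
      have := (Real.hasDerivAt_arcsin n1.1 n1.2).comp x h1
      refine HasDerivAt.congr_deriv this ?_
      symm
      rw [e1]; field_simp
    have d3 : HasDerivAt (fun y => Real.arcsin (c * y / (ρ * √(q ^ 2 + y ^ 2))))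
        (c * q / (t ^ 2 * s)) x := by
      have h1 : HasDerivAt (fun y => (c * y) / (ρ * √(q ^ 2 + y ^ 2)))
          ((c * (ρ * t) - (c * x) * (ρ * (x / t))) / (ρ * t) ^ 2) x := by
        apply HasDerivAt.div
        · simpa using ((hasDerivAt_id x).const_mul c)
        · exact dt.const_mul ρ
        · positivity
      have := (Real.hasDerivAt_arcsin n2.1 n2.2).comp x h1
      refine HasDerivAt.congr_deriv this ?_
      symm
      rw [e2]; field_simp
      rw [ht2]; ring
    have := ((d3.const_mul (c / q)).sub d2).const_mul 2
    refine HasDerivAt.congr_deriv this ?_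
    symm
    have hcs : c - s ≠ 0 := by linarith
    have hcs' : c + s ≠ 0 := by linarith
    have h3 : (c - s) * (c + s) = t ^ 2 := by rw [ht2, hq2]; nlinarith
    have h4 : (c - s)⁻¹ - (c + s)⁻¹ = 2 * s / t ^ 2 := by
      rw [← h3]; field_simp; ring
    rw [h4]
    field_simp
    rw [ht2, hs2, hq2]; ring
  have hint : IntervalIntegrable (fun x => (c - √(ρ ^ 2 - x ^ 2))⁻¹ - (c + √(ρ ^ 2 - x ^ 2))⁻¹)
      MeasureTheory.volume (-ρ) ρ := by
    apply Continuous.intervalIntegrable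
    apply Continuous.sub
    · apply Continuous.inv₀ (by fun_prop)
      intro x; have := hsle x; linarith
    · apply Continuous.inv₀ (by fun_prop)
      intro x; have := Real.sqrt_nonneg (ρ ^ 2 - x ^ 2); linarith
  rw [intervalIntegral.integral_eq_sub_of_hasDerivAt_of_le (by linarith) hFc.continuousOn hFd hint]
  have hsq : √(q ^ 2 + ρ ^ 2) = c := by
    rw [hq2]; simp [Real.sqrt_sq hc0.le]
  have hsq' : √(q ^ 2 + (-ρ) ^ 2) = c := by
    rw [neg_sq]; exact hsq
  have v1 : c * ρ / (ρ * c) = 1 := by field_simp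
  have v2 : c * (-ρ) / (ρ * c) = -1 := by field_simp
  have v3 : -ρ / ρ = -1 := by field_simp
  simp only [F, hsq, hsq', v1, v2, v3, div_self hρ.ne', Real.arcsin_one, Real.arcsin_neg_one]
  ring

end HypIso

namespace HypIso
open Set Filter Topology
lemma dini_aux {s t : ℝ} {Λ G : ℝ → ℝ} (hst : s ≤ t) (hΛ : ContinuousOn Λ (Icc s t))
    (hG : ContinuousOn G (Icc s t))
    (h : ∀ x ∈ Ico s t, ∃ G', HasDerivWithinAt G G' (Ici x) x ∧
      ∀ r < G', ∃ᶠ z in 𝓝[>] x, r < slope Λ x z) : G t - G s ≤ Λ t - Λ s := by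
  choose! G' hG' hG2 using h
  have := image_le_of_liminf_slope_right_le_deriv_boundary (f := fun x => -Λ x + Λ s)
    (B := fun x => - G x + G s) (B' := fun x => - G' x) (a := s) (b := t)
    (hΛ.neg.add continuousOn_const) (by simp) (hG.neg.add continuousOn_const)
    (fun x hx => by simpa using (hG' x hx).neg.add_const (G s))
    (fun x hx r hr => by
      refine (hG2 x hx (-r) (by linarith)).mono fun z hz => ?_
      have : slope (fun x => -Λ x + Λ s) x z = - slope Λ x z := by
        simp only [slope_def_field]; ring
      rw [this]; linarith)
    (⟨hst, le_rfl⟩ : t ∈ Icc s t)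
  linarith

lemma dini {s t : ℝ} {Λ G : ℝ → ℝ} (hst : s ≤ t) (hΛ : ContinuousOn Λ (Icc s t))
    (hG : ContinuousOn G (Icc s t))
    (h : ∀ x ∈ Ioo s t, ∃ G', HasDerivWithinAt G G' (Ici x) x ∧
      ∀ r < G', ∃ᶠ z in 𝓝[>] x, r < slope Λ x z) : G t - G s ≤ Λ t - Λ s := by
  rcases hst.eq_or_lt with rfl | hlt
  · simp
  have hT : Tendsto (fun u => (Λ t - Λ u) - (G t - G u)) (𝓝[>] s) (𝓝 ((Λ t - Λ s) - (G t - G s))) := by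
    have h1 : Tendsto Λ (𝓝[>] s) (𝓝 (Λ s)) := by
      have := (hΛ s ⟨le_rfl, hst⟩).mono Ioc_subset_Icc_self
      rwa [ContinuousWithinAt, nhdsWithin_Ioc_eq_nhdsGT hlt] at this
    have h2 : Tendsto G (𝓝[>] s) (𝓝 (G s)) := by
      have := (hG s ⟨le_rfl, hst⟩).mono Ioc_subset_Icc_self
      rwa [ContinuousWithinAt, nhdsWithin_Ioc_eq_nhdsGT hlt] at this
    exact (tendsto_const_nhds.sub h1).sub (tendsto_const_nhds.sub h2)
  have : 0 ≤ (Λ t - Λ s) - (G t - G s) := by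
    apply ge_of_tendsto hT
    filter_upwards [Ioc_mem_nhdsGT hlt] with u hu
    have := dini_aux hu.2 (hΛ.mono (Icc_subset_Icc_left hu.1.le)) (hG.mono (Icc_subset_Icc_left hu.1.le))
      (fun x hx => h x ⟨lt_of_lt_of_le hu.1 hx.1, hx.2⟩)
    linarith
  linarith

/-- hyperbolic distance between points of a graph -/
noncomputable def gd (f : ℝ → ℝ) (u v : ℝ) : ℝ :=
  2 * Real.arsinh (√((v - u) ^ 2 + (f v - f u) ^ 2) / (2 * √(f u * f v)))

lemma tendsto_gd {f : ℝ → ℝ} {x m : ℝ} (hf : HasDerivWithinAt f m (Ioi x) x) (hpos : 0 < f x) :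
    Tendsto (fun z => gd f x z / (z - x)) (𝓝[>] x) (𝓝 (√(1 + m ^ 2) / f x)) := by
  have hs : Tendsto (slope f x) (𝓝[>] x) (𝓝 m) := by
    have := hasDerivWithinAt_iff_tendsto_slope.mp hf
    simpa using this
  have hc : Tendsto f (𝓝[>] x) (𝓝 (f x)) := hf.continuousWithinAt
  have hN : Tendsto (fun z => √(1 + slope f x z ^ 2) / (2 * √(f x * f z))) (𝓝[>] x)
      (𝓝 (√(1 + m ^ 2) / (2 * f x))) := by
    have h1 : Tendsto (fun z => √(1 + slope f x z ^ 2)) (𝓝[>] x) (𝓝 (√(1 + m ^ 2))) :=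
      ((hs.pow 2).const_add 1).sqrt
    have h2 : Tendsto (fun z => 2 * √(f x * f z)) (𝓝[>] x) (𝓝 (2 * f x)) := by
      have := ((hc.const_mul (f x)).sqrt).const_mul 2
      rwa [Real.sqrt_mul_self hpos.le] at this
    exact h1.div h2 (by positivity)
  have hz : Tendsto (fun z => z - x) (𝓝[>] x) (𝓝 0) := by
    have : Continuous fun z => z - x := by fun_prop
    have := this.tendsto x
    simp only [sub_self] at this
    exact this.mono_left nhdsWithin_le_nhds
  have hds : ContinuousAt (dslope Real.arsinh 0) 0 := by
    rw [continuousAt_dslope_same]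
    exact (Real.differentiable_arsinh 0)
  have hd0 : dslope Real.arsinh 0 0 = 1 := by
    rw [dslope_same, (Real.hasDerivAt_arsinh 0).deriv]; simp
  have hk := hds.tendsto.comp (by simpa using hz.mul hN :
    Tendsto (fun z => (z - x) * (√(1 + slope f x z ^ 2) / (2 * √(f x * f z)))) (𝓝[>] x) (𝓝 0))
  have hfin := (hN.mul hk).const_mul 2
  rw [hd0] at hfin
  have e : 2 * (√(1 + m ^ 2) / (2 * f x) * 1) = √(1 + m ^ 2) / f x := by field_simp
  rw [e] at hfin
  refine hfin.congr' ?_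
  filter_upwards [self_mem_nhdsWithin] with z hz
  have hzx : 0 < z - x := sub_pos.mpr hz
  have h1 : √((z - x) ^ 2 + (f z - f x) ^ 2) = (z - x) * √(1 + slope f x z ^ 2) := by
    rw [slope_def_field]
    have : (z - x) ^ 2 + (f z - f x) ^ 2 = (z - x) ^ 2 * (1 + ((f z - f x) / (z - x)) ^ 2) := by
      field_simp
    rw [this, Real.sqrt_mul (sq_nonneg _), Real.sqrt_sq hzx.le]
  simp only [gd, Function.comp, h1]
  set N := √(1 + slope f x z ^ 2) / (2 * √(f x * f z)) with hNd
  have h2 : (z - x) * √(1 + slope f x z ^ 2) / (2 * √(f x * f z)) = (z - x) * N := by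
    rw [hNd]; ring
  rw [h2]
  have h3 := sub_smul_dslope Real.arsinh 0 ((z - x) * N)
  simp only [sub_zero, smul_eq_mul, Real.arsinh_zero] at h3
  rw [← h3]
  field_simp

/-- The setting: `f` is a graph on `[s,t]` with heights in `[a,b]`. -/
structure Gr (a b s t : ℝ) (f : ℝ → ℝ) : Prop where
  ha : 0 < a
  hab : a < b
  hst : s < t
  cont : ContinuousOn f (Icc s t)
  lo : ∀ x ∈ Icc s t, a ≤ f x
  hi : ∀ x ∈ Icc s t, f x ≤ b
  der : ∀ x ∈ Ioo s t, ∃ m, HasDerivWithinAt f m (Ioi x) x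

noncomputable def II (a b s : ℝ) (f : ℝ → ℝ) (x : ℝ) : ℝ :=
  ∫ u in s..x, ((a + b) / 2 / f u - 1) / ((b - a) / 2)

lemma Gr.pos {a b s t : ℝ} {f : ℝ → ℝ} (hf : Gr a b s t f) {x : ℝ} (hx : x ∈ Icc s t) :
    0 < f x := lt_of_lt_of_le hf.ha (hf.lo x hx)

lemma Gr.icont {a b s t : ℝ} {f : ℝ → ℝ} (hf : Gr a b s t f) :
    ContinuousOn (fun u => ((a + b) / 2 / f u - 1) / ((b - a) / 2)) (Icc s t) := by
  apply ContinuousOn.div_const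
  apply ContinuousOn.sub _ continuousOn_const
  exact continuousOn_const.div hf.cont fun x hx => (hf.pos hx).ne'

lemma Gr.II_cont {a b s t : ℝ} {f : ℝ → ℝ} (hf : Gr a b s t f) :
    ContinuousOn (II a b s f) (Icc s t) := by
  unfold II
  have := intervalIntegral.continuousOn_primitive_interval (μ := MeasureTheory.volume)
    (a := s) (b := t)
    (f := fun u => ((a + b) / 2 / f u - 1) / ((b - a) / 2)) (by
      rw [uIcc_of_le hf.hst.le]
      exact hf.icont.integrableOn_Icc)
  rwa [uIcc_of_le hf.hst.le] at this

lemma Gr.II_deriv {a b s t : ℝ} {f : ℝ → ℝ} (hf : Gr a b s t f) {x : ℝ} (hx : x ∈ Ioo s t) :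
    HasDerivAt (II a b s f) (((a + b) / 2 / f x - 1) / ((b - a) / 2)) x := by
  have hint : IntervalIntegrable (fun u => ((a + b) / 2 / f u - 1) / ((b - a) / 2))
      MeasureTheory.volume s x := by
    apply ContinuousOn.intervalIntegrable
    rw [uIcc_of_le hx.1.le]
    exact hf.icont.mono (Icc_subset_Icc_right hx.2.le)
  apply intervalIntegral.integral_hasDerivAt_right hint
  · exact (hf.icont.mono Ioo_subset_Icc_self).stronglyMeasurableAtFilter isOpen_Ioo x hx
  · exact (hf.icont.mono Ioo_subset_Icc_self).continuousAt (isOpen_Ioo.mem_nhds hx)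

lemma Gr.H_cont {a b s t : ℝ} {f : ℝ → ℝ} (hf : Gr a b s t f) :
    ContinuousOn (fun x => HH a b (f x)) (Icc s t) := by
  intro x hx
  exact (HH_deriv hf.ha hf.hab (hf.pos hx)).continuousAt.comp_continuousWithinAt (hf.cont x hx)

/-- right derivative of the calibration primitive -/
lemma Gr.G_deriv {a b s t : ℝ} {f : ℝ → ℝ} (hf : Gr a b s t f) (σ τ : ℝ) {x m : ℝ}
    (hx : x ∈ Ioo s t) (hm : HasDerivWithinAt f m (Ioi x) x) :
    HasDerivWithinAt (fun x => σ * HH a b (f x) + τ * II a b s f x)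
      ((σ * hh a b (f x) * m + τ * ((a + b) / 2 - f x)) / ((b - a) / 2 * f x)) (Ici x) x := by
  have hp := hf.pos (Ioo_subset_Icc_self hx)
  have hba : 0 < b - a := by linarith [hf.hab]
  have h1 := ((HH_deriv hf.ha hf.hab hp).comp_hasDerivWithinAt x hm.Ici_of_Ioi).const_mul σ
  have h2 := ((hf.II_deriv hx).hasDerivWithinAt (s := Ici x)).const_mul τ
  refine (h1.add h2).congr_deriv ?_
  field_simp

lemma cs_ineq {p q m ρ : ℝ} (hρ : 0 < ρ) (h : p ^ 2 + q ^ 2 = ρ ^ 2) :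
    p * m + q ≤ ρ * √(1 + m ^ 2) := by
  apply le_of_sq_le_sq _ (by positivity)
  rw [mul_pow, Real.sq_sqrt (by positivity), ← h]
  nlinarith [sq_nonneg (p - q * m)]

lemma cs_eq {p q m ρ : ℝ} (hρ : 0 < ρ) (h : p ^ 2 + q ^ 2 = ρ ^ 2)
    (he : ρ * √(1 + m ^ 2) ≤ p * m + q) : 0 < q ∧ p = q * m := by
  have hs : 0 < √(1 + m ^ 2) := Real.sqrt_pos.mpr (by positivity)
  have h1 : (ρ * √(1 + m ^ 2)) ^ 2 ≤ (p * m + q) ^ 2 := by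
    apply pow_le_pow_left₀ (by positivity) he
  rw [mul_pow, Real.sq_sqrt (by positivity), ← h] at h1
  have h2 : (p - q * m) ^ 2 ≤ 0 := by nlinarith
  have h3 : p = q * m := by nlinarith [pow_eq_zero_iff (two_ne_zero) |>.mp (le_antisymm h2 (sq_nonneg _))]
  refine ⟨?_, h3⟩
  have : 0 < p * m + q := lt_of_lt_of_le (by positivity) he
  rw [h3] at this
  by_contra hq
  push Not at hq
  nlinarith [sq_nonneg m]

lemma Gr.norm_eq {a b s t : ℝ} {f : ℝ → ℝ} (hf : Gr a b s t f) {σ τ : ℝ} (hσ : σ ^ 2 = 1)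
    (hτ : τ ^ 2 = 1) {x : ℝ} (hx : x ∈ Icc s t) :
    (σ * hh a b (f x)) ^ 2 + (τ * ((a + b) / 2 - f x)) ^ 2 = ((b - a) / 2) ^ 2 := by
  rw [mul_pow, mul_pow, hσ, hτ, hh_sq (hf.lo x hx) (hf.hi x hx)]; ring

/-- `Λ` dominates the length of the graph. -/
def Dom (f Λ : ℝ → ℝ) (s t : ℝ) : Prop :=
  ContinuousOn Λ (Icc s t) ∧ ∀ u ∈ Icc s t, ∀ v ∈ Icc s t, u ≤ v → gd f u v ≤ Λ v - Λ u

theorem Gr.calib {a b s t : ℝ} {f : ℝ → ℝ} (hf : Gr a b s t f) {Λ : ℝ → ℝ} (hΛ : Dom f Λ s t)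
    {σ τ : ℝ} (hσ : σ ^ 2 = 1) (hτ : τ ^ 2 = 1) {u v : ℝ} (hu : u ∈ Icc s t) (hv : v ∈ Icc s t)
    (huv : u ≤ v) :
    (σ * HH a b (f v) + τ * II a b s f v) - (σ * HH a b (f u) + τ * II a b s f u) ≤ Λ v - Λ u := by
  have hsub : Icc u v ⊆ Icc s t := Icc_subset_Icc hu.1 hv.2
  have hsub' : Ioo u v ⊆ Ioo s t := Ioo_subset_Ioo hu.1 hv.2
  have hba : 0 < b - a := by linarith [hf.hab]
  refine dini (G := fun x => σ * HH a b (f x) + τ * II a b s f x) huv (hΛ.1.mono hsub)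
    (((continuousOn_const.mul hf.H_cont).add (continuousOn_const.mul hf.II_cont)).mono hsub) ?_
  intro x hx
  obtain ⟨m, hm⟩ := hf.der x (hsub' hx)
  have hxI := Ioo_subset_Icc_self (hsub' hx)
  have hp := hf.pos hxI
  refine ⟨_, hf.G_deriv σ τ (hsub' hx) hm, fun r hr => ?_⟩
  have hlt : r < √(1 + m ^ 2) / f x := by
    refine lt_of_lt_of_le hr ?_
    rw [div_le_div_iff₀ (by positivity) hp]
    have := cs_ineq (m := m) (by positivity : 0 < (b - a) / 2) (hf.norm_eq hσ hτ hxI)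
    nlinarith
  apply Eventually.frequently
  filter_upwards [(tendsto_gd hm hp).eventually_const_lt hlt, Ioo_mem_nhdsGT (hsub' hx).2] with z hz hzx
  refine lt_of_lt_of_le hz ?_
  rw [slope_def_field]
  have : 0 < z - x := sub_pos.mpr hzx.1
  gcongr
  exact hΛ.2 x hxI z ⟨by linarith [hxI.1, hzx.1], hzx.2.le⟩ hzx.1.le

theorem Gr.calib_eq {a b s t : ℝ} {f : ℝ → ℝ} (hf : Gr a b s t f) {Λ : ℝ → ℝ} (hΛ : Dom f Λ s t)
    {σ τ : ℝ} (hσ : σ ^ 2 = 1) (hτ : τ ^ 2 = 1) {u v : ℝ} (hu : u ∈ Icc s t) (hv : v ∈ Icc s t)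
    (heq : Λ v - Λ u ≤
      (σ * HH a b (f v) + τ * II a b s f v) - (σ * HH a b (f u) + τ * II a b s f u))
    {x m : ℝ} (hx : x ∈ Ioo u v) (hm : HasDerivWithinAt f m (Ioi x) x) :
    0 < τ * ((a + b) / 2 - f x) ∧ σ * hh a b (f x) = τ * ((a + b) / 2 - f x) * m := by
  have hsub' : Ioo u v ⊆ Ioo s t := Ioo_subset_Ioo hu.1 hv.2
  have hba : 0 < b - a := by linarith [hf.hab]
  have hxI := Ioo_subset_Icc_self (hsub' hx)
  have hp := hf.pos hxI
  apply cs_eq (by positivity : 0 < (b - a) / 2) (hf.norm_eq hσ hτ hxI)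
  have hd := (hf.G_deriv σ τ (hsub' hx) hm)
  have hd2 := hasDerivWithinAt_iff_tendsto_slope.mp hd
  simp only [Ici_sdiff_left] at hd2
  have hle := le_of_tendsto_of_tendsto (tendsto_gd hm hp) hd2 (by
    filter_upwards [Ioo_mem_nhdsGT hx.2] with z hz
    have hzI : z ∈ Icc s t := ⟨by linarith [hxI.1, hz.1], by linarith [hv.2, hz.2]⟩
    rw [slope_def_field]
    have h1 := hf.calib hΛ hσ hτ hu hxI hx.1.le
    have h2 := hf.calib hΛ hσ hτ hzI hv hz.2.le
    have h3 := hΛ.2 x hxI z hzI hz.1.le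
    have : 0 < z - x := sub_pos.mpr hz.1
    gcongr
    linarith)
  rw [div_le_div_iff₀ hp (by positivity)] at hle
  have : (f x) * ((b - a) / 2 * √(1 + m ^ 2)) ≤ f x * (σ * hh a b (f x) * m + τ * ((a + b) / 2 - f x)) := by
    nlinarith
  exact le_of_mul_le_mul_left this hp

/-- the differential equation for square roots -/
lemma ode_le {u v ε : ℝ} {q : ℝ → ℝ} (hε : ε ^ 2 = 1) (huv : u ≤ v) (hq : ContinuousOn q (Icc u v))
    (hq0 : ∀ x ∈ Icc u v, 0 ≤ q x)
    (hd : ∀ x ∈ Ioo u v, HasDerivWithinAt q (2 * ε * √(q x)) (Ici x) x) :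
    ε * (√(q v) - √(q u)) ≤ v - u := by
  have key : ∀ δ : ℝ, 0 < δ → ε * √(q v + δ) - ε * √(q u + δ) ≤ v - u := by
    intro δ hδ
    refine dini (Λ := fun x => x) (G := fun x => ε * √(q x + δ)) huv continuousOn_id
      (continuousOn_const.mul (hq.add continuousOn_const).sqrt) ?_
    intro x hx
    have h0 := hq0 x (Ioo_subset_Icc_self hx)
    have hs : 0 < √(q x + δ) := Real.sqrt_pos.mpr (by linarith)
    refine ⟨_, (((hd x hx).add_const δ).sqrt (by linarith)).const_mul ε, fun r hr => ?_⟩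
    have h1 : ε * (2 * ε * √(q x) / (2 * √(q x + δ))) ≤ 1 := by
      have : ε * (2 * ε * √(q x) / (2 * √(q x + δ))) = ε ^ 2 * √(q x) / √(q x + δ) := by
        field_simp
      rw [this, hε, one_mul, div_le_one hs]
      exact Real.sqrt_le_sqrt (by linarith)
    apply Eventually.frequently
    filter_upwards [self_mem_nhdsWithin] with z hz
    have : 0 < z - x := sub_pos.mpr hz
    rw [slope_def_field, div_self this.ne']
    linarith
  have hT : Tendsto (fun δ => ε * √(q v + δ) - ε * √(q u + δ)) (𝓝[>] 0)
      (𝓝 (ε * √(q v) - ε * √(q u))) := by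
    have : Continuous (fun δ => ε * √(q v + δ) - ε * √(q u + δ)) := by fun_prop
    have := this.tendsto 0
    simp only [add_zero] at this
    exact this.mono_left nhdsWithin_le_nhds
  have := le_of_tendsto hT (by filter_upwards [self_mem_nhdsWithin] with δ hδ using key δ hδ)
  linarith

lemma ode_eq {u v ε : ℝ} {q : ℝ → ℝ} (hε : ε ^ 2 = 1) (huv : u ≤ v) (hq : ContinuousOn q (Icc u v))
    (hq0 : ∀ x ∈ Ioo u v, 0 < q x)
    (hd : ∀ x ∈ Ioo u v, HasDerivWithinAt q (2 * ε * √(q x)) (Ici x) x) :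
    ε * (√(q v) - √(q u)) = v - u := by
  have hder : ∀ x ∈ Ioo u v, HasDerivWithinAt (fun x => ε * √(q x)) 1 (Ici x) x := by
    intro x hx
    have h0 := hq0 x hx
    have hs : 0 < √(q x) := Real.sqrt_pos.mpr h0
    refine (((hd x hx).sqrt h0.ne').const_mul ε).congr_deriv ?_
    field_simp
    linarith
  have hcont : ContinuousOn (fun x => ε * √(q x)) (Icc u v) := continuousOn_const.mul hq.sqrt
  have h1 := dini (Λ := fun x => x) (G := fun x => ε * √(q x)) huv continuousOn_id hcont
    (fun x hx => ⟨1, hder x hx, fun r hr => by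
      apply Eventually.frequently
      filter_upwards [self_mem_nhdsWithin] with z hz
      have : 0 < z - x := sub_pos.mpr hz
      rw [slope_def_field, div_self this.ne']
      exact hr⟩)
  have h2 := dini (G := fun x => x) (Λ := fun x => ε * √(q x)) huv hcont continuousOn_id
    (fun x hx => ⟨1, hasDerivWithinAt_id _ _, fun r hr => by
      have := hasDerivWithinAt_iff_tendsto_slope.mp (hder x hx)
      simp only [Ici_sdiff_left] at this
      exact (this.eventually_const_lt hr).frequently⟩)
  linarith

end HypIso

namespace HypIso
open Set Filter Topology
lemma hh_le {a b y : ℝ} (hab : a < b) : hh a b y ≤ (b - a) / 2 := by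
  unfold hh
  rw [Real.sqrt_le_left (by linarith)]
  nlinarith [sq_nonneg (y - (a + b) / 2)]

lemma logH_deriv {a b y : ℝ} (ha : 0 < a) (hab : a < b) (hy : 0 < y) :
    HasDerivAt (fun y => Real.log y - HH a b y) (((b - a) / 2 - hh a b y) / ((b - a) / 2 * y)) y := by
  have hba : 0 < b - a := by linarith
  refine ((Real.hasDerivAt_log hy.ne').sub (HH_deriv ha hab hy)).congr_deriv ?_
  field_simp

lemma logH_mono {a b : ℝ} (ha : 0 < a) (hab : a < b) :
    MonotoneOn (fun y => Real.log y - HH a b y) (Ioi 0) := by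
  have hba : 0 < b - a := by linarith
  apply monotoneOn_of_deriv_nonneg (convex_Ioi 0)
  · exact fun y hy => (logH_deriv ha hab hy).continuousAt.continuousWithinAt
  · rw [interior_Ioi]
    exact fun y hy => (logH_deriv ha hab hy).differentiableAt.differentiableWithinAt
  · rw [interior_Ioi]
    intro y hy
    have hy' : 0 < y := hy
    rw [(logH_deriv ha hab hy).deriv]
    have := hh_le (y := y) hab
    apply div_nonneg (by linarith) (by positivity)

lemma logH_strict {a b p q : ℝ} (ha : 0 < a) (hab : a < b) (hp : 0 < p) (hpq : p ≤ q)
    (h : Real.log q - HH a b q ≤ Real.log p - HH a b p) : p = q := by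
  by_contra hne
  have hlt : p < q := lt_of_le_of_ne hpq hne
  have hba : 0 < b - a := by linarith
  have hmono := logH_mono ha hab
  have key : ∀ y ∈ Ioo p q, y = (a + b) / 2 := by
    intro y hy
    have hy0 : 0 < y := hp.trans hy.1
    have hconst : (fun y => Real.log y - HH a b y) =ᶠ[𝓝 y] fun _ => Real.log p - HH a b p := by
      filter_upwards [isOpen_Ioo.mem_nhds hy] with z hz
      have hz0 : 0 < z := hp.trans hz.1
      have h1 := hmono (show p ∈ Ioi 0 from hp) (show z ∈ Ioi 0 from hz0) hz.1.le
      have h2 := hmono (show z ∈ Ioi 0 from hz0) (show q ∈ Ioi 0 from hp.trans hlt) hz.2.le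
      simp only at h1 h2
      linarith
    have hd0 : HasDerivAt (fun y => Real.log y - HH a b y) 0 y :=
      (hasDerivAt_const y _).congr_of_eventuallyEq hconst
    have := hd0.unique (logH_deriv ha hab hy0)
    have h3 : (b - a) / 2 - hh a b y = 0 := by
      rw [eq_comm, div_eq_zero_iff] at this
      rcases this with h | h
      · exact h
      · exfalso; have : 0 < (b - a) / 2 * y := by positivity
        linarith
    have h4 : hh a b y = (b - a) / 2 := by linarith
    unfold hh at h4
    rw [Real.sqrt_eq_iff_mul_self_eq_of_pos (by positivity)] at h4
    nlinarith [sq_nonneg (y - (a + b) / 2), pow_eq_zero_iff (two_ne_zero) |>.mp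
      (show (y - (a + b) / 2) ^ 2 = 0 by nlinarith)]
  have k1 := key ((2 * p + q) / 3) ⟨by linarith, by linarith⟩
  have k2 := key ((p + 2 * q) / 3) ⟨by linarith, by linarith⟩
  linarith

/-- All the data extracted from the convex body. -/
structure Body (a b x1 x2 xb xt : ℝ) (f1 f2 Λ1 Λ2 : ℝ → ℝ) : Prop where
  g1 : Gr a b x1 x2 f1
  g2 : Gr a b x1 x2 f2
  d1 : Dom f1 Λ1 x1 x2
  d2 : Dom f2 Λ2 x1 x2
  hxb : xb ∈ Icc x1 x2
  hxt : xt ∈ Icc x1 x2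
  fb : f1 xb = a
  ft : f2 xt = b
  ftu : ∀ x ∈ Icc x1 x2, f2 x = b → x = xt
  le : ∀ x ∈ Icc x1 x2, f1 x ≤ f2 x

lemma II_self (a b s : ℝ) (f : ℝ → ℝ) : II a b s f s = 0 := by simp [II]

lemma Body.II_sub {a b x1 x2 xb xt : ℝ} {f1 f2 Λ1 Λ2 : ℝ → ℝ} (B : Body a b x1 x2 xb xt f1 f2 Λ1 Λ2) :
    (b - a) / 2 * (II a b x1 f1 x2 - II a b x1 f2 x2) =
      (a + b) / 2 * ∫ x in x1..x2, ((f1 x)⁻¹ - (f2 x)⁻¹) := by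
  have hba : 0 < b - a := by linarith [B.g1.hab]
  have i1 := B.g1.icont.intervalIntegrable_of_Icc (μ := MeasureTheory.volume) B.g1.hst.le
  have i2 := B.g2.icont.intervalIntegrable_of_Icc (μ := MeasureTheory.volume) B.g1.hst.le
  unfold II
  rw [← intervalIntegral.integral_sub i1 i2, ← intervalIntegral.integral_const_mul,
    ← intervalIntegral.integral_const_mul]
  congr 1; ext x
  field_simp
  ring

section
variable {a b x1 x2 xb xt : ℝ} {f1 f2 Λ1 Λ2 : ℝ → ℝ}

lemma Body.x1m (B : Body a b x1 x2 xb xt f1 f2 Λ1 Λ2) : x1 ∈ Icc x1 x2 := ⟨le_rfl, B.g1.hst.le⟩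
lemma Body.x2m (B : Body a b x1 x2 xb xt f1 f2 Λ1 Λ2) : x2 ∈ Icc x1 x2 := ⟨B.g1.hst.le, le_rfl⟩

lemma Body.c1 (B : Body a b x1 x2 xb xt f1 f2 Λ1 Λ2) :
    HH a b (f1 x2) + II a b x1 f1 x2 - II a b x1 f1 xb ≤ Λ1 x2 - Λ1 xb := by
  have := B.g1.calib B.d1 (σ := 1) (τ := 1) (by norm_num) (by norm_num) B.hxb B.x2m B.hxb.2
  rw [B.fb, HH_a] at this
  linarith

lemma Body.c2 (B : Body a b x1 x2 xb xt f1 f2 Λ1 Λ2) :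
    HH a b (f1 x1) + II a b x1 f1 xb ≤ Λ1 xb - Λ1 x1 := by
  have := B.g1.calib B.d1 (σ := -1) (τ := 1) (by norm_num) (by norm_num) B.x1m B.hxb B.hxb.1
  rw [B.fb, HH_a, II_self] at this
  linarith

lemma Body.c3 (B : Body a b x1 x2 xb xt f1 f2 Λ1 Λ2) :
    HH a b b - HH a b (f2 x2) - II a b x1 f2 x2 + II a b x1 f2 xt ≤ Λ2 x2 - Λ2 xt := by
  have := B.g2.calib B.d2 (σ := -1) (τ := -1) (by norm_num) (by norm_num) B.hxt B.x2m B.hxt.2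
  rw [B.ft] at this
  linarith

lemma Body.c4 (B : Body a b x1 x2 xb xt f1 f2 Λ1 Λ2) :
    HH a b b - HH a b (f2 x1) - II a b x1 f2 xt ≤ Λ2 xt - Λ2 x1 := by
  have := B.g2.calib B.d2 (σ := 1) (τ := -1) (by norm_num) (by norm_num) B.x1m B.hxt B.hxt.1
  rw [B.ft, II_self] at this
  linarith

lemma Body.c5 (B : Body a b x1 x2 xb xt f1 f2 Λ1 Λ2) {x : ℝ} (hx : x ∈ Icc x1 x2) :
    HH a b (f2 x) - HH a b (f1 x) ≤ Real.log (f2 x) - Real.log (f1 x) := by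
  have := logH_mono B.g1.ha B.g1.hab (show f1 x ∈ Ioi 0 from B.g1.pos hx)
    (show f2 x ∈ Ioi 0 from B.g2.pos hx) (B.le x hx)
  simp only at this
  linarith

/-- total length bound -/
noncomputable def totLen (x1 x2 : ℝ) (f1 f2 Λ1 Λ2 : ℝ → ℝ) : ℝ :=
  (Λ1 x2 - Λ1 x1) + (Λ2 x2 - Λ2 x1) + (Real.log (f2 x1) - Real.log (f1 x1)) +
    (Real.log (f2 x2) - Real.log (f1 x2))

lemma Body.rhs (B : Body a b x1 x2 xb xt f1 f2 Λ1 Λ2) :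
    (b - a) / 2 * (2 * HH a b b + (II a b x1 f1 x2 - II a b x1 f2 x2)) =
    (a + b) / 2 * (∫ x in x1..x2, ((f1 x)⁻¹ - (f2 x)⁻¹)) +
      2 * Real.pi * ((a + b) / 2 - √(a * b)) := by
  have := HH_b B.g1.ha B.g1.hab
  rw [mul_add, B.II_sub]
  linarith

theorem Body.ineq (B : Body a b x1 x2 xb xt f1 f2 Λ1 Λ2) :
    (a + b) / 2 * (∫ x in x1..x2, ((f1 x)⁻¹ - (f2 x)⁻¹)) +
      2 * Real.pi * ((a + b) / 2 - √(a * b)) ≤ (b - a) / 2 * totLen x1 x2 f1 f2 Λ1 Λ2 := by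
  have hba : 0 < b - a := by linarith [B.g1.hab]
  rw [← B.rhs]
  apply mul_le_mul_of_nonneg_left _ (by positivity)
  unfold totLen
  linarith [B.c1, B.c2, B.c3, B.c4, B.c5 B.x1m, B.c5 B.x2m]

lemma q_deriv {f : ℝ → ℝ} {σ τ x m : ℝ} (hτ : τ ^ 2 = 1)
    (hm : HasDerivWithinAt f m (Ioi x) x)
    (h : σ * hh a b (f x) = τ * ((a + b) / 2 - f x) * m) :
    HasDerivWithinAt (fun x => (b - f x) * (f x - a)) (2 * (σ * τ) * √((b - f x) * (f x - a)))
      (Ici x) x := by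
  refine ((hm.Ici_of_Ioi.const_sub b).mul (hm.Ici_of_Ioi.sub_const a)).congr_deriv ?_
  have h1 : √((b - f x) * (f x - a)) = hh a b (f x) := rfl
  rw [h1]
  have h2 : 2 * (σ * τ) * hh a b (f x) = τ ^ 2 * (2 * (((a + b) / 2 - f x) * m)) := by
    linear_combination (2 * τ) * h
  rw [h2, hτ]; ring

theorem Body.rigid (B : Body a b x1 x2 xb xt f1 f2 Λ1 Λ2)
    (hE : (b - a) / 2 * totLen x1 x2 f1 f2 Λ1 Λ2 ≤
      (a + b) / 2 * (∫ x in x1..x2, ((f1 x)⁻¹ - (f2 x)⁻¹)) +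
      2 * Real.pi * ((a + b) / 2 - √(a * b))) :
    x1 = xt - (b - a) / 2 ∧ x2 = xt + (b - a) / 2 ∧ ∀ x ∈ Icc x1 x2,
      f1 x ≤ (a + b) / 2 ∧ (a + b) / 2 ≤ f2 x ∧
      (x - xt) ^ 2 + (f1 x - (a + b) / 2) ^ 2 = ((b - a) / 2) ^ 2 ∧
      (x - xt) ^ 2 + (f2 x - (a + b) / 2) ^ 2 = ((b - a) / 2) ^ 2 := by
  have hba : 0 < b - a := by linarith [B.g1.hab]
  rw [← B.rhs] at hE
  have hE' := le_of_mul_le_mul_left hE (by positivity)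
  unfold totLen at hE'
  have c1 := B.c1
  have c2 := B.c2
  have c3 := B.c3
  have c4 := B.c4
  have c5 := B.c5 B.x1m
  have c6 := B.c5 B.x2m
  -- pointwise equalities
  have e1 := fun x m => B.g1.calib_eq B.d1 (σ := 1) (τ := 1) (by norm_num) (by norm_num) B.hxb B.x2m
    (by rw [B.fb, HH_a]; linarith) (x := x) (m := m)
  have e2 := fun x m => B.g1.calib_eq B.d1 (σ := -1) (τ := 1) (by norm_num) (by norm_num) B.x1m B.hxb
    (by rw [B.fb, HH_a, II_self]; linarith) (x := x) (m := m)
  have e3 := fun x m => B.g2.calib_eq B.d2 (σ := -1) (τ := -1) (by norm_num) (by norm_num) B.hxt B.x2m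
    (by rw [B.ft]; linarith) (x := x) (m := m)
  have e4 := fun x m => B.g2.calib_eq B.d2 (σ := 1) (τ := -1) (by norm_num) (by norm_num) B.x1m B.hxt
    (by rw [B.ft, II_self]; linarith) (x := x) (m := m)
  have s1 := logH_strict B.g1.ha B.g1.hab (B.g1.pos B.x1m) (B.le x1 B.x1m) (by linarith)
  have s2 := logH_strict B.g1.ha B.g1.hab (B.g1.pos B.x2m) (B.le x2 B.x2m) (by linarith)
  have sub1 : Icc xb x2 ⊆ Icc x1 x2 := Icc_subset_Icc_left B.hxb.1
  have sub2 : Icc x1 xb ⊆ Icc x1 x2 := Icc_subset_Icc_right B.hxb.2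
  have sub3 : Icc xt x2 ⊆ Icc x1 x2 := Icc_subset_Icc_left B.hxt.1
  have sub4 : Icc x1 xt ⊆ Icc x1 x2 := Icc_subset_Icc_right B.hxt.2
  have sub1' : Ioo xb x2 ⊆ Ioo x1 x2 := Ioo_subset_Ioo_left B.hxb.1
  have sub2' : Ioo x1 xb ⊆ Ioo x1 x2 := Ioo_subset_Ioo_right B.hxb.2
  have sub3' : Ioo xt x2 ⊆ Ioo x1 x2 := Ioo_subset_Ioo_left B.hxt.1
  have sub4' : Ioo x1 xt ⊆ Ioo x1 x2 := Ioo_subset_Ioo_right B.hxt.2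
  -- side of the centre line
  have lo_int : ∀ x ∈ Ioo x1 x2, f1 x ≤ (a + b) / 2 := by
    intro x hx
    obtain ⟨m, hm⟩ := B.g1.der x hx
    rcases lt_trichotomy x xb with h | h | h
    · have := (e2 x m ⟨hx.1, h⟩ hm).1; linarith
    · rw [h, B.fb]; linarith
    · have := (e1 x m ⟨h, hx.2⟩ hm).1; linarith
  have hi_int : ∀ x ∈ Ioo x1 x2, (a + b) / 2 ≤ f2 x := by
    intro x hx
    obtain ⟨m, hm⟩ := B.g2.der x hx
    rcases lt_trichotomy x xt with h | h | h
    · have := (e4 x m ⟨hx.1, h⟩ hm).1; linarith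
    · rw [h, B.ft]; linarith
    · have := (e3 x m ⟨h, hx.2⟩ hm).1; linarith
  have hcl : closure (Ioo x1 x2) = Icc x1 x2 := closure_Ioo B.g1.hst.ne
  have lo_all : ∀ x ∈ Icc x1 x2, f1 x ≤ (a + b) / 2 := by
    intro x hx
    have := ContinuousWithinAt.closure_le (s := Ioo x1 x2) (by rw [hcl]; exact hx)
      ((B.g1.cont x hx).mono Ioo_subset_Icc_self) continuousWithinAt_const lo_int
    exact this
  have hi_all : ∀ x ∈ Icc x1 x2, (a + b) / 2 ≤ f2 x := by
    intro x hx
    have := ContinuousWithinAt.closure_le (s := Ioo x1 x2) (by rw [hcl]; exact hx)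
      continuousWithinAt_const ((B.g2.cont x hx).mono Ioo_subset_Icc_self) hi_int
    exact this
  have v1 : f1 x1 = (a + b) / 2 := by linarith [lo_all x1 B.x1m, hi_all x1 B.x1m]
  have v2 : f1 x2 = (a + b) / 2 := by linarith [lo_all x2 B.x2m, hi_all x2 B.x2m]
  -- q functions
  have qc1 : ContinuousOn (fun x => (b - f1 x) * (f1 x - a)) (Icc x1 x2) :=
    (continuousOn_const.sub B.g1.cont).mul (B.g1.cont.sub continuousOn_const)
  have qc2 : ContinuousOn (fun x => (b - f2 x) * (f2 x - a)) (Icc x1 x2) :=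
    (continuousOn_const.sub B.g2.cont).mul (B.g2.cont.sub continuousOn_const)
  have qn1 : ∀ x ∈ Icc x1 x2, 0 ≤ (b - f1 x) * (f1 x - a) := fun x hx =>
    mul_nonneg (by linarith [B.g1.hi x hx]) (by linarith [B.g1.lo x hx])
  have qn2 : ∀ x ∈ Icc x1 x2, 0 ≤ (b - f2 x) * (f2 x - a) := fun x hx =>
    mul_nonneg (by linarith [B.g2.hi x hx]) (by linarith [B.g2.lo x hx])
  have qp2 : ∀ x ∈ Icc x1 x2, x ≠ xt → 0 < (b - f2 x) * (f2 x - a) := fun x hx hne => by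
    apply mul_pos
    · exact sub_pos.mpr (lt_of_le_of_ne (B.g2.hi x hx) fun h => hne (B.ftu x hx h))
    · linarith [hi_all x hx]
  have qd1 : ∀ x ∈ Ioo xb x2, HasDerivWithinAt (fun x => (b - f1 x) * (f1 x - a))
      (2 * 1 * √((b - f1 x) * (f1 x - a))) (Ici x) x := fun x hx => by
    obtain ⟨m, hm⟩ := B.g1.der x (sub1' hx)
    have := q_deriv (by norm_num) hm (e1 x m hx hm).2
    convert this using 3; norm_num
  have qd2 : ∀ x ∈ Ioo x1 xb, HasDerivWithinAt (fun x => (b - f1 x) * (f1 x - a))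
      (2 * (-1) * √((b - f1 x) * (f1 x - a))) (Ici x) x := fun x hx => by
    obtain ⟨m, hm⟩ := B.g1.der x (sub2' hx)
    have := q_deriv (by norm_num) hm (e2 x m hx hm).2
    convert this using 3; norm_num
  have qd3 : ∀ x ∈ Ioo xt x2, HasDerivWithinAt (fun x => (b - f2 x) * (f2 x - a))
      (2 * 1 * √((b - f2 x) * (f2 x - a))) (Ici x) x := fun x hx => by
    obtain ⟨m, hm⟩ := B.g2.der x (sub3' hx)
    have := q_deriv (by norm_num) hm (e3 x m hx hm).2
    convert this using 3; norm_num
  have qd4 : ∀ x ∈ Ioo x1 xt, HasDerivWithinAt (fun x => (b - f2 x) * (f2 x - a))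
      (2 * (-1) * √((b - f2 x) * (f2 x - a))) (Ici x) x := fun x hx => by
    obtain ⟨m, hm⟩ := B.g2.der x (sub4' hx)
    have := q_deriv (by norm_num) hm (e4 x m hx hm).2
    convert this using 3; norm_num
  have hmid : √((b - (a + b) / 2) * ((a + b) / 2 - a)) = (b - a) / 2 := by
    rw [show (b - (a + b) / 2) * ((a + b) / 2 - a) = ((b - a) / 2) ^ 2 by ring]
    exact Real.sqrt_sq (by positivity)
  -- upper arcs exactly
  have up_r : ∀ x ∈ Icc xt x2, √((b - f2 x) * (f2 x - a)) = x - xt := by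
    intro x hx
    have := ode_eq (u := xt) (v := x) (ε := 1) (by norm_num) hx.1
      (qc2.mono (Icc_subset_Icc B.hxt.1 hx.2))
      (fun y hy => qp2 y (sub3 ⟨hy.1.le, hy.2.le.trans hx.2⟩) hy.1.ne')
      (fun y hy => qd3 y ⟨hy.1, lt_of_lt_of_le hy.2 hx.2⟩)
    simp only [B.ft, sub_self, zero_mul, Real.sqrt_zero] at this
    linarith
  have up_l : ∀ x ∈ Icc x1 xt, √((b - f2 x) * (f2 x - a)) = xt - x := by
    intro x hx
    have := ode_eq (u := x) (v := xt) (ε := -1) (by norm_num) hx.2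
      (qc2.mono (Icc_subset_Icc hx.1 B.hxt.2))
      (fun y hy => qp2 y (sub4 ⟨hx.1.trans hy.1.le, hy.2.le⟩) hy.2.ne)
      (fun y hy => qd4 y ⟨lt_of_le_of_lt hx.1 hy.1, hy.2⟩)
    simp only [B.ft, sub_self, zero_mul, Real.sqrt_zero] at this
    linarith
  have hx2 : x2 = xt + (b - a) / 2 := by
    have := up_r x2 ⟨B.hxt.2, le_rfl⟩
    rw [← s2, v2, hmid] at this
    linarith
  have hx1 : x1 = xt - (b - a) / 2 := by
    have := up_l x1 ⟨le_rfl, B.hxt.1⟩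
    rw [← s1, v1, hmid] at this
    linarith
  -- lower arcs
  have lo_r : ∀ u ∈ Icc xb x2, ∀ v ∈ Icc xb x2, u ≤ v →
      √((b - f1 v) * (f1 v - a)) - √((b - f1 u) * (f1 u - a)) ≤ v - u := by
    intro u hu v hv huv
    have := ode_le (u := u) (v := v) (ε := 1) (by norm_num) huv
      (qc1.mono (Icc_subset_Icc (B.hxb.1.trans hu.1) hv.2))
      (fun y hy => qn1 y (sub1 ⟨hu.1.trans hy.1, hy.2.trans hv.2⟩))
      (fun y hy => qd1 y ⟨lt_of_le_of_lt hu.1 hy.1, lt_of_lt_of_le hy.2 hv.2⟩)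
    linarith
  have lo_l : ∀ u ∈ Icc x1 xb, ∀ v ∈ Icc x1 xb, u ≤ v →
      √((b - f1 u) * (f1 u - a)) - √((b - f1 v) * (f1 v - a)) ≤ v - u := by
    intro u hu v hv huv
    have := ode_le (u := u) (v := v) (ε := -1) (by norm_num) huv
      (qc1.mono (Icc_subset_Icc hu.1 (hv.2.trans B.hxb.2)))
      (fun y hy => qn1 y (sub2 ⟨hu.1.trans hy.1, hy.2.trans hv.2⟩))
      (fun y hy => qd2 y ⟨lt_of_le_of_lt hu.1 hy.1, lt_of_lt_of_le hy.2 hv.2⟩)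
    linarith
  have hzb : √((b - f1 xb) * (f1 xb - a)) = 0 := by rw [B.fb]; simp
  have hm2 : √((b - f1 x2) * (f1 x2 - a)) = (b - a) / 2 := by rw [v2]; exact hmid
  have hm1 : √((b - f1 x1) * (f1 x1 - a)) = (b - a) / 2 := by rw [v1]; exact hmid
  have k1 := lo_r xb ⟨le_rfl, B.hxb.2⟩ x2 ⟨B.hxb.2, le_rfl⟩ B.hxb.2
  have k2 := lo_l x1 ⟨le_rfl, B.hxb.1⟩ xb ⟨B.hxb.1, le_rfl⟩ B.hxb.1
  have hbt : xb = xt := by linarith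
  have dn_r : ∀ x ∈ Icc xb x2, √((b - f1 x) * (f1 x - a)) = x - xb := by
    intro x hx
    have := lo_r xb ⟨le_rfl, B.hxb.2⟩ x hx hx.1
    have := lo_r x hx x2 ⟨B.hxb.2, le_rfl⟩ hx.2
    linarith
  have dn_l : ∀ x ∈ Icc x1 xb, √((b - f1 x) * (f1 x - a)) = xb - x := by
    intro x hx
    have := lo_l x hx xb ⟨B.hxb.1, le_rfl⟩ hx.2
    have := lo_l x1 ⟨le_rfl, B.hxb.1⟩ x hx hx.1
    linarith
  refine ⟨hx1, hx2, fun x hx => ⟨lo_all x hx, hi_all x hx, ?_, ?_⟩⟩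
  · have : √((b - f1 x) * (f1 x - a)) ^ 2 = (x - xt) ^ 2 := by
      rcases le_total xb x with h | h
      · rw [dn_r x ⟨h, hx.2⟩, hbt]
      · rw [dn_l x ⟨hx.1, h⟩, hbt]; ring
    rw [Real.sq_sqrt (qn1 x hx)] at this
    linarith
  · have : √((b - f2 x) * (f2 x - a)) ^ 2 = (x - xt) ^ 2 := by
      rcases le_total xt x with h | h
      · rw [up_r x ⟨h, hx.2⟩]
      · rw [up_l x ⟨hx.1, h⟩]; ring
    rw [Real.sq_sqrt (qn2 x hx)] at this
    linarith

end
end HypIso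

namespace HypIso
open Set Filter Topology

lemma dist_add_of_seg (z1 z2 z : ℍ) (s t : ℝ) (hs : 0 ≤ s) (ht : 0 ≤ t) (hst : s + t = 1)
    (hx : z.re = s * z1.re + t * z2.re)
    (hw : z.re ^ 2 + z.im ^ 2 = s * (z1.re ^ 2 + z1.im ^ 2) + t * (z2.re ^ 2 + z2.im ^ 2)) :
    dist z1 z + dist z z2 = dist z1 z2 := by
  have hy := z.im_pos
  have hy1 := z1.im_pos
  have hy2 := z2.im_pos
  have c12 := UpperHalfPlane.cosh_dist' z1 z2
  have c1 := UpperHalfPlane.cosh_dist' z1 z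
  have c2 := UpperHalfPlane.cosh_dist' z z2
  set x := z.re
  set y := z.im
  set x1 := z1.re
  set y1 := z1.im
  set x2 := z2.re
  set y2 := z2.im
  obtain ⟨B, hB⟩ : ∃ B, B = ((x1 - x2) ^ 2 + y1 ^ 2 + y2 ^ 2) / 2 := ⟨_, rfl⟩
  have hs' : s = 1 - t := by linarith
  have hyy : y ^ 2 = s ^ 2 * y1 ^ 2 + t ^ 2 * y2 ^ 2 + 2 * s * t * B := by
    have : y ^ 2 = s * (x1 ^ 2 + y1 ^ 2) + t * (x2 ^ 2 + y2 ^ 2) - x ^ 2 := by linarith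
    rw [this, hx, hB, hs']; ring
  have e12 : Real.cosh (dist z1 z2) * (y1 * y2) = B := by
    rw [c12, hB]; field_simp
  have e1 : Real.cosh (dist z1 z) * (y1 * y) = s * y1 ^ 2 + t * B := by
    rw [c1, hB]; field_simp
    have : (x1 - x) ^ 2 + y1 ^ 2 + y ^ 2 = x1 ^ 2 + y1 ^ 2 - 2 * x1 * x + (x ^ 2 + y ^ 2) := by ring
    rw [this, hw, hx, hs']; ring
  have e2 : Real.cosh (dist z z2) * (y * y2) = t * y2 ^ 2 + s * B := by
    rw [c2, hB]; field_simp
    have : (x - x2) ^ 2 + y ^ 2 + y2 ^ 2 = x2 ^ 2 + y2 ^ 2 - 2 * x2 * x + (x ^ 2 + y ^ 2) := by ring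
    rw [this, hw, hx, hs']; ring
  have q12 := Real.cosh_sq (dist z1 z2)
  have q1 := Real.cosh_sq (dist z1 z)
  have q2 := Real.cosh_sq (dist z z2)
  have p12 : 0 ≤ Real.sinh (dist z1 z2) := Real.sinh_nonneg_iff.2 dist_nonneg
  have p1 : 0 ≤ Real.sinh (dist z1 z) := Real.sinh_nonneg_iff.2 dist_nonneg
  have p2 : 0 ≤ Real.sinh (dist z z2) := Real.sinh_nonneg_iff.2 dist_nonneg
  have cadd := Real.cosh_add (dist z1 z) (dist z z2)
  have key : Real.cosh (dist z1 z + dist z z2) = Real.cosh (dist z1 z2) := by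
    rw [cadd]
    set C := Real.cosh (dist z1 z2)
    set C1 := Real.cosh (dist z1 z)
    set C2 := Real.cosh (dist z z2)
    set S := Real.sinh (dist z1 z2)
    set S1 := Real.sinh (dist z1 z)
    set S2 := Real.sinh (dist z z2)
    have r1 : S1 * y = t * y2 * S := by
      apply (sq_eq_sq₀ (by positivity) (by positivity)).1
      have : y1 ^ 2 * (S1 * y) ^ 2 = y1 ^ 2 * (t * y2 * S) ^ 2 := by
        have h1 : y1 ^ 2 * (S1 * y) ^ 2 = (C1 * (y1 * y)) ^ 2 - y1 ^ 2 * y ^ 2 := by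
          linear_combination (-(y1 ^ 2 * y ^ 2)) * q1
        have h2 : y1 ^ 2 * (t * y2 * S) ^ 2 = t ^ 2 * ((C * (y1 * y2)) ^ 2 - y1 ^ 2 * y2 ^ 2) := by
          linear_combination (-(t ^ 2 * y1 ^ 2 * y2 ^ 2)) * q12
        rw [h1, h2, e1, e12, hyy]; ring
      exact mul_left_cancel₀ (by positivity) this
    have r2 : S2 * y = s * y1 * S := by
      apply (sq_eq_sq₀ (by positivity) (by positivity)).1
      have : y2 ^ 2 * (S2 * y) ^ 2 = y2 ^ 2 * (s * y1 * S) ^ 2 := by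
        have h1 : y2 ^ 2 * (S2 * y) ^ 2 = (C2 * (y * y2)) ^ 2 - y2 ^ 2 * y ^ 2 := by
          linear_combination (-(y2 ^ 2 * y ^ 2)) * q2
        have h2 : y2 ^ 2 * (s * y1 * S) ^ 2 = s ^ 2 * ((C * (y1 * y2)) ^ 2 - y1 ^ 2 * y2 ^ 2) := by
          linear_combination (-(s ^ 2 * y1 ^ 2 * y2 ^ 2)) * q12
        rw [h1, h2, e2, e12, hyy]; ring
      exact mul_left_cancel₀ (by positivity) this
    have : (y1 * y2 * y ^ 2) * (C1 * C2 + S1 * S2) = (y1 * y2 * y ^ 2) * C := by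
      have h1 : (y1 * y2 * y ^ 2) * (C1 * C2 + S1 * S2) =
          (C1 * (y1 * y)) * (C2 * (y * y2)) + y1 * y2 * (S1 * y) * (S2 * y) := by ring
      have h2 : (y1 * y2 * y ^ 2) * C = y ^ 2 * (C * (y1 * y2)) := by ring
      have h3 : (y1 * y2 * S) ^ 2 = (C * (y1 * y2)) ^ 2 - y1 ^ 2 * y2 ^ 2 := by
        linear_combination (-(y1 ^ 2 * y2 ^ 2)) * q12
      rw [h1, h2, r1, r2, e1, e2]
      rw [e12] at h3 ⊢
      rw [hyy]
      linear_combination (s * t) * h3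
    exact mul_left_cancel₀ (by positivity) this
  exact Real.cosh_injOn (mem_Ici.2 (by positivity)) (mem_Ici.2 dist_nonneg) key

end HypIso

namespace HypIso
open Set Filter Topology

/-- coordinates in which geodesics are straight lines -/
noncomputable def psi (z : ℍ) : ℝ × ℝ := (z.re, z.re ^ 2 + z.im ^ 2)

lemma psi_cont : Continuous psi := by
  unfold psi
  have h1 := UpperHalfPlane.continuous_re
  have h2 := UpperHalfPlane.continuous_im
  fun_prop

lemma psi_inj {z w : ℍ} (h : psi z = psi w) : z = w := by
  simp only [psi, Prod.mk.injEq] at h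
  obtain ⟨h1, h2⟩ := h
  have h3 : z.im ^ 2 = w.im ^ 2 := by rw [h1] at h2; linarith
  have h4 := (sq_eq_sq₀ z.im_pos.le w.im_pos.le).1 h3
  exact UpperHalfPlane.ext (Complex.ext h1 h4)

lemma psi_convex {K : Set ℍ} (hK : HypConvex K) : Convex ℝ (psi '' K) := by
  rintro _ ⟨z1, h1, rfl⟩ _ ⟨z2, h2, rfl⟩ s t hs ht hst
  have hy1 := z1.im_pos
  have hy2 := z2.im_pos
  set x := s * z1.re + t * z2.re with hx
  set w := s * (z1.re ^ 2 + z1.im ^ 2) + t * (z2.re ^ 2 + z2.im ^ 2) with hw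
  have hpos : 0 < w - x ^ 2 := by
    have : w - x ^ 2 = s * t * (z1.re - z2.re) ^ 2 + s * z1.im ^ 2 + t * z2.im ^ 2 := by
      have hs' : s = 1 - t := by linarith
      rw [hw, hx, hs']; ring
    rw [this]
    have a1 : 0 ≤ s * t * (z1.re - z2.re) ^ 2 := by positivity
    rcases hs.eq_or_lt with h | h
    · have : t = 1 := by linarith
      rw [this]; rw [← h]; simp; positivity
    · have : 0 < s * z1.im ^ 2 := by positivity
      have : 0 ≤ t * z2.im ^ 2 := by positivity
      linarith
  let z : ℍ := ⟨⟨x, √(w - x ^ 2)⟩, Real.sqrt_pos.2 hpos⟩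
  have zre : z.re = x := rfl
  have zim : z.im = √(w - x ^ 2) := rfl
  have zw : z.re ^ 2 + z.im ^ 2 = w := by
    rw [zre, zim, Real.sq_sqrt hpos.le]; ring
  refine ⟨z, hK z1 h1 z2 h2 z (dist_add_of_seg z1 z2 z s t hs ht hst zre zw), ?_⟩
  have : psi z = (x, w) := by
    simp only [psi]
    rw [zw, zre]
  rw [this]
  simp [psi, hx, hw]

lemma psi_interior {K : Set ℍ} (hK : (interior K).Nonempty) : (interior (psi '' K)).Nonempty := by
  obtain ⟨z0, hz0⟩ := hK
  refine ⟨psi z0, mem_interior_iff_mem_nhds.2 ?_⟩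
  have ho : IsOpen ((fun z : ℍ => (z : ℂ)) '' interior K) :=
    UpperHalfPlane.isOpenEmbedding_coe.isOpenMap _ isOpen_interior
  let F : ℝ × ℝ → ℂ := fun p => (p.1 : ℂ) + (√(p.2 - p.1 ^ 2) : ℝ) * Complex.I
  have hF : Continuous F := by
    have : Continuous (fun p : ℝ × ℝ => √(p.2 - p.1 ^ 2)) := by fun_prop
    exact (Complex.continuous_ofReal.comp continuous_fst).add
      ((Complex.continuous_ofReal.comp this).mul continuous_const)
  have hF0 : F (psi z0) = (z0 : ℂ) := by
    apply Complex.ext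
    · simp [F, psi]
    · simp [F, psi, Real.sqrt_sq z0.im_pos.le]
  have : ∀ᶠ p in 𝓝 (psi z0), F p ∈ (fun z : ℍ => (z : ℂ)) '' interior K := by
    apply hF.continuousAt.eventually_mem
    rw [hF0]
    exact ho.mem_nhds ⟨z0, hz0, rfl⟩
  filter_upwards [this] with p hp
  obtain ⟨z, hz, hzp⟩ := hp
  refine ⟨z, interior_subset hz, ?_⟩
  have h1 : z.re = p.1 := by
    have := congrArg Complex.re hzp
    simpa [F] using this
  have h2 : z.im = √(p.2 - p.1 ^ 2) := by
    have := congrArg Complex.im hzp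
    simpa [F] using this
  have h3 : 0 < p.2 - p.1 ^ 2 := by
    have := z.im_pos
    rw [h2] at this
    exact Real.sqrt_pos.1 this
  simp only [psi]
  rw [h1, h2, Real.sq_sqrt h3.le]
  ext <;> simp

/-- Description of a compact convex body with nonempty interior as a region between two graphs. -/
structure Sl (K : Set ℍ) (a b x1 x2 xb xt : ℝ) (f1 f2 : ℝ → ℝ) : Prop where
  g1 : Gr a b x1 x2 f1
  g2 : Gr a b x1 x2 f2
  hxb : xb ∈ Icc x1 x2
  hxt : xt ∈ Icc x1 x2
  fb : f1 xb = a
  ft : f2 xt = b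
  ftu : ∀ x ∈ Icc x1 x2, f2 x = b → x = xt
  le : ∀ x ∈ Icc x1 x2, f1 x ≤ f2 x
  lt : ∀ x ∈ Ioo x1 x2, f1 x < f2 x
  cv : ConvexOn ℝ (Icc x1 x2) (fun x => f1 x ^ 2 + x ^ 2)
  cc : ConcaveOn ℝ (Icc x1 x2) (fun x => f2 x ^ 2 + x ^ 2)
  mem : ∀ z : ℍ, z ∈ K ↔ z.re ∈ Icc x1 x2 ∧ f1 z.re ≤ z.im ∧ z.im ≤ f2 z.re

theorem exists_sl (K : Set ℍ) (hc : IsCompact K) (hcv : HypConvex K) (hi : (interior K).Nonempty) :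
    ∃ a b x1 x2 xb xt f1 f2, Sl K a b x1 x2 xb xt f1 f2 := by
  obtain ⟨x1, x2, g1, g2, h12, cg1, cg2, cv, cc, gle, glt, gm⟩ :=
    convex_slices (psi '' K) (hc.image psi_cont) (psi_convex hcv) (psi_interior hi)
  have pos1 : ∀ x ∈ Icc x1 x2, 0 < g1 x - x ^ 2 := by
    intro x hx
    obtain ⟨z, hz, hzp⟩ := (gm x (g1 x)).2 ⟨hx, le_rfl, gle x hx⟩
    simp only [psi, Prod.mk.injEq] at hzp
    obtain ⟨e1, e2⟩ := hzp
    have := z.im_pos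
    rw [← e2, e1]
    simp; positivity
  have pos2 : ∀ x ∈ Icc x1 x2, 0 < g2 x - x ^ 2 := fun x hx =>
    (pos1 x hx).trans_le (by linarith [gle x hx])
  let f1 : ℝ → ℝ := fun x => √(g1 x - x ^ 2)
  let f2 : ℝ → ℝ := fun x => √(g2 x - x ^ 2)
  have c1 : ContinuousOn f1 (Icc x1 x2) := by
    apply ContinuousOn.sqrt; fun_prop
  have c2 : ContinuousOn f2 (Icc x1 x2) := by
    apply ContinuousOn.sqrt; fun_prop
  have s1 : ∀ x ∈ Icc x1 x2, f1 x ^ 2 + x ^ 2 = g1 x := fun x hx => by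
    simp only [f1]; rw [Real.sq_sqrt (pos1 x hx).le]; ring
  have s2 : ∀ x ∈ Icc x1 x2, f2 x ^ 2 + x ^ 2 = g2 x := fun x hx => by
    simp only [f2]; rw [Real.sq_sqrt (pos2 x hx).le]; ring
  have fp1 : ∀ x ∈ Icc x1 x2, 0 < f1 x := fun x hx => Real.sqrt_pos.2 (pos1 x hx)
  have fp2 : ∀ x ∈ Icc x1 x2, 0 < f2 x := fun x hx => Real.sqrt_pos.2 (pos2 x hx)
  have le : ∀ x ∈ Icc x1 x2, f1 x ≤ f2 x := fun x hx =>
    Real.sqrt_le_sqrt (by linarith [gle x hx])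
  have lt : ∀ x ∈ Ioo x1 x2, f1 x < f2 x := fun x hx =>
    Real.sqrt_lt_sqrt (pos1 x (Ioo_subset_Icc_self hx)).le (by linarith [glt x hx])
  have d1 : ∀ x ∈ Ioo x1 x2, ∃ m, HasDerivWithinAt f1 m (Ioi x) x := by
    intro x hx
    have h := cv.hasDerivWithinAt_rightDeriv_of_mem_interior (x := x) (by rwa [interior_Icc])
    have h2 : HasDerivWithinAt (fun x : ℝ => x ^ 2) _ (Ioi x) x :=
      ((hasDerivAt_pow 2 x).hasDerivWithinAt)
    exact ⟨_, (h.sub h2).sqrt (pos1 x (Ioo_subset_Icc_self hx)).ne'⟩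
  have d2 : ∀ x ∈ Ioo x1 x2, ∃ m, HasDerivWithinAt f2 m (Ioi x) x := by
    intro x hx
    have h := (cc.neg.hasDerivWithinAt_rightDeriv_of_mem_interior (x := x)
      (by rwa [interior_Icc])).neg
    rw [neg_neg] at h
    have h2 : HasDerivWithinAt (fun x : ℝ => x ^ 2) _ (Ioi x) x :=
      ((hasDerivAt_pow 2 x).hasDerivWithinAt)
    exact ⟨_, (h.sub h2).sqrt (pos2 x (Ioo_subset_Icc_self hx)).ne'⟩
  have ne : (Icc x1 x2).Nonempty := nonempty_Icc.2 h12.le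
  obtain ⟨xb, hxb, hb⟩ := isCompact_Icc.exists_isMinOn ne c1
  obtain ⟨xt, hxt, ht⟩ := isCompact_Icc.exists_isMaxOn ne c2
  have hb' : ∀ x ∈ Icc x1 x2, f1 xb ≤ f1 x := fun x hx => hb hx
  have ht' : ∀ x ∈ Icc x1 x2, f2 x ≤ f2 xt := fun x hx => ht hx
  have hm : (x1 + x2) / 2 ∈ Ioo x1 x2 := ⟨by linarith, by linarith⟩
  have hm' := Ioo_subset_Icc_self hm
  have hab : f1 xb < f2 xt := by linarith [hb' _ hm', ht' _ hm', lt _ hm]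
  refine ⟨f1 xb, f2 xt, x1, x2, xb, xt, f1, f2, ?_⟩
  refine ⟨⟨fp1 _ hxb, hab, h12, c1, hb', fun x hx => (le x hx).trans (ht' x hx), d1⟩,
    ⟨fp1 _ hxb, hab, h12, c2, fun x hx => (hb' x hx).trans (le x hx), ht', d2⟩,
    hxb, hxt, rfl, rfl, ?_, le, lt, cv.congr fun x hx => (s1 x hx).symm,
    cc.congr fun x hx => (s2 x hx).symm, ?_⟩
  · intro x hx hxe
    by_contra hne
    have hmid : (1 / 2 : ℝ) • x + (1 / 2 : ℝ) • xt ∈ Icc x1 x2 :=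
      (convex_Icc x1 x2) hx hxt (by norm_num) (by norm_num) (by norm_num)
    have h := cc.2 hx hxt (by norm_num : (0 : ℝ) ≤ 1 / 2) (by norm_num : (0 : ℝ) ≤ 1 / 2) (by norm_num)
    have hM := ht' _ hmid
    have hp := fp2 _ hmid
    rw [← s2 _ hmid, ← s2 _ hx, ← s2 _ hxt, hxe] at h
    simp only [smul_eq_mul] at h hM hp
    have : 0 < (x - xt) ^ 2 := by have := sub_ne_zero.2 hne; positivity
    nlinarith
  · intro z
    have hz : z ∈ K ↔ psi z ∈ psi '' K :=
      ⟨fun h => ⟨z, h, rfl⟩, fun ⟨w, hw, e⟩ => psi_inj e ▸ hw⟩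
    rw [hz]
    simp only [psi]
    rw [gm]
    refine and_congr_right fun hx => and_congr ?_ ?_
    · rw [Real.sqrt_le_left z.im_pos.le]
      constructor <;> intro h <;> linarith
    · rw [Real.le_sqrt' z.im_pos]
      constructor <;> intro h <;> linarith
end HypIso

namespace HypIso
open Set Filter Topology

lemma fin_mono (T : Set ℍ) (a b M e : ℝ) (ha : 0 < a) (him : ∀ z ∈ T, a ≤ z.im)
    (hib : ∀ z ∈ T, z.im ≤ b) (hre : ∀ z ∈ T, |z.re| ≤ M) (he : e ^ 2 = 1)
    (hm : ∀ z ∈ T, ∀ w ∈ T, 0 ≤ e * (z.re - w.re) *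
      ((z.re ^ 2 + z.im ^ 2) - (w.re ^ 2 + w.im ^ 2))) :
    μH[1] T < ⊤ := by
  by_cases hM : 0 ≤ M
  swap
  · have : T = ∅ := by
      apply eq_empty_of_forall_notMem
      intro z hz
      exact hM ((abs_nonneg _).trans (hre z hz))
    rw [this]; simp
  let σ : T → ℝ := fun z => z.1.re + e * (z.1.re ^ 2 + z.1.im ^ 2)
  let C : ℝ := (1 + (1 + 2 * M) / a) / a
  have hC : 0 ≤ C := by positivity
  have hA : AntilipschitzWith ⟨C, hC⟩ σ := by
    apply AntilipschitzWith.of_le_mul_dist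
    rintro ⟨z, hz⟩ ⟨w, hw⟩
    change dist z w ≤ C * dist (z.re + e * (z.re ^ 2 + z.im ^ 2)) (w.re + e * (w.re ^ 2 + w.im ^ 2))
    rw [Real.dist_eq]
    have h0 := hm z hz w hw
    have hz1 := him z hz
    have hw1 := him w hw
    have hz2 := hre z hz
    have hw2 := hre w hw
    set p := z.re - w.re with hp
    set q := (z.re ^ 2 + z.im ^ 2) - (w.re ^ 2 + w.im ^ 2) with hq
    set D := |(z.re + e * (z.re ^ 2 + z.im ^ 2)) - (w.re + e * (w.re ^ 2 + w.im ^ 2))| with hD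
    have hD2 : D ^ 2 = p ^ 2 + q ^ 2 + 2 * (e * p * q) := by
      rw [hD, sq_abs, hp, hq]
      linear_combination (((z.re ^ 2 + z.im ^ 2) - (w.re ^ 2 + w.im ^ 2)) ^ 2) * he
    have hD0 : 0 ≤ D := abs_nonneg _
    have hpD : |p| ≤ D := abs_le_of_sq_le_sq (by nlinarith [sq_nonneg q]) hD0
    have hqD : |q| ≤ D := abs_le_of_sq_le_sq (by nlinarith [sq_nonneg p]) hD0
    have hr : |z.im - w.im| ≤ (1 + 2 * M) / a * D := by
      have e1 : (z.im - w.im) * (z.im + w.im) = q - p * (z.re + w.re) := by rw [hp, hq]; ring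
      have e2 : |z.im - w.im| * (z.im + w.im) = |q - p * (z.re + w.re)| := by
        rw [← e1, abs_mul, abs_of_pos (a := z.im + w.im) (by linarith)]
      have e3 : |q - p * (z.re + w.re)| ≤ D + D * (2 * M) := by
        refine (abs_sub _ _).trans ?_
        rw [abs_mul]
        have : |z.re + w.re| ≤ 2 * M := (abs_add_le _ _).trans (by linarith)
        have := mul_le_mul hpD this (abs_nonneg _) hD0
        linarith
      rw [div_mul_eq_mul_div, le_div_iff₀ ha]
      have : |z.im - w.im| * a ≤ |z.im - w.im| * (z.im + w.im) :=
        mul_le_mul_of_nonneg_left (by linarith) (abs_nonneg _)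
      nlinarith
    have h1 := UpperHalfPlane.dist_le_dist_coe_div_sqrt z w
    have h2 : dist (z : ℂ) w ≤ |p| + |z.im - w.im| := by
      rw [Complex.dist_eq]
      have := Complex.norm_le_abs_re_add_abs_im ((z : ℂ) - w)
      simpa [hp] using this
    have h3 : a ≤ √(z.im * w.im) := by
      apply Real.le_sqrt_of_sq_le
      nlinarith
    calc dist z w ≤ dist (z : ℂ) w / √(z.im * w.im) := h1
      _ ≤ dist (z : ℂ) w / a := by
        apply div_le_div_of_nonneg_left dist_nonneg ha h3
      _ ≤ (D + (1 + 2 * M) / a * D) / a := by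
        apply div_le_div_of_nonneg_right _ ha.le
        linarith
      _ = C * D := by simp only [C]; field_simp
  have h1 : μH[1] T = μH[1] (univ : Set T) := by
    have hiso : Isometry (Subtype.val : T → ℍ) := isometry_subtype_coe
    have := hiso.hausdorffMeasure_image (d := 1) (Or.inl zero_le_one) univ
    rw [← this]
    simp
  have h2 := hA.le_hausdorffMeasure_image (d := 1) zero_le_one univ
  rw [h1]
  refine h2.trans_lt ?_
  have h3 : σ '' univ ⊆ Icc (-(M + (M ^ 2 + b ^ 2))) (M + (M ^ 2 + b ^ 2)) := by
    rintro _ ⟨⟨z, hz⟩, -, rfl⟩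
    change z.re + e * (z.re ^ 2 + z.im ^ 2) ∈ _
    rw [mem_Icc, ← abs_le]
    have he1 : |e| = 1 := by
      have : |e| ^ 2 = 1 := by rw [sq_abs, he]
      exact (pow_eq_one_iff_of_nonneg (abs_nonneg e) two_ne_zero).1 this
    have hz1 := him z hz
    have hz2 := hre z hz
    have hz3 := hib z hz
    refine (abs_add_le _ _).trans ?_
    rw [abs_mul, he1, one_mul, abs_of_nonneg (a := z.re ^ 2 + z.im ^ 2) (by positivity)]
    have : z.re ^ 2 ≤ M ^ 2 := sq_le_sq' (by linarith [(abs_le.1 hz2).1]) (abs_le.1 hz2).2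
    have : z.im ^ 2 ≤ b ^ 2 := pow_le_pow_left₀ z.im_pos.le hz3 2
    linarith
  have h4 : μH[1] (σ '' univ) < ⊤ := by
    refine (measure_mono h3).trans_lt ?_
    rw [hausdorffMeasure_real]
    exact measure_Icc_lt_top
  exact ENNReal.mul_lt_top (by rw [ENNReal.rpow_one]; exact ENNReal.coe_lt_top) h4

/-- the part of the graph of `f` over `S` -/
def gra (f : ℝ → ℝ) (S : Set ℝ) : Set ℍ := {z | z.re ∈ S ∧ z.im = f z.re}

lemma gra_union (f : ℝ → ℝ) (S T : Set ℝ) : gra f (S ∪ T) = gra f S ∪ gra f T := by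
  ext z; simp [gra, or_and_right]

lemma fin_gra {a b x1 x2 : ℝ} {f : ℝ → ℝ} (G : Gr a b x1 x2 f) (e : ℝ) (he : e ^ 2 = 1)
    (hc : ConvexOn ℝ (Icc x1 x2) (fun x => e * (f x ^ 2 + x ^ 2))) :
    μH[1] (gra f (Icc x1 x2)) < ⊤ := by
  have cont : ContinuousOn (fun x => e * (f x ^ 2 + x ^ 2)) (Icc x1 x2) := by
    have := G.cont
    fun_prop
  obtain ⟨m, hm, hmin⟩ := isCompact_Icc.exists_isMinOn (nonempty_Icc.2 G.hst.le) cont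
  have hmin' : ∀ x ∈ Icc x1 x2, e * (f m ^ 2 + m ^ 2) ≤ e * (f x ^ 2 + x ^ 2) := fun x hx => hmin hx
  have A1 : ∀ x ∈ Icc x1 m, ∀ y ∈ Icc x1 m, x ≤ y →
      e * (f y ^ 2 + y ^ 2) ≤ e * (f x ^ 2 + x ^ 2) := by
    intro x hx y hy hxy
    have hx' : x ∈ Icc x1 x2 := ⟨hx.1, hx.2.trans hm.2⟩
    have := hc.le_max_of_mem_Icc hx' hm (z := y) ⟨hxy, hy.2⟩
    rwa [max_eq_left (hmin' x hx')] at this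
  have A2 : ∀ x ∈ Icc m x2, ∀ y ∈ Icc m x2, x ≤ y →
      e * (f x ^ 2 + x ^ 2) ≤ e * (f y ^ 2 + y ^ 2) := by
    intro x hx y hy hxy
    have hy' : y ∈ Icc x1 x2 := ⟨hm.1.trans hy.1, hy.2⟩
    have := hc.le_max_of_mem_Icc hm hy' (z := x) ⟨hx.1, hxy⟩
    rwa [max_eq_right (hmin' y hy')] at this
  have hu : Icc x1 x2 = Icc x1 m ∪ Icc m x2 := (Icc_union_Icc_eq_Icc hm.1 hm.2).symm
  have hM : ∀ x ∈ Icc x1 x2, |x| ≤ max |x1| |x2| := fun x hx => abs_le_max_abs_abs hx.1 hx.2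
  rw [hu, gra_union]
  refine (measure_union_le _ _).trans_lt (ENNReal.add_lt_top.2 ⟨?_, ?_⟩)
  · have hs : Icc x1 m ⊆ Icc x1 x2 := Icc_subset_Icc_right hm.2
    refine fin_mono _ a b (max |x1| |x2|) (-e) G.ha ?_ ?_ ?_ (by rw [neg_sq, he]) ?_
    · rintro z ⟨h1, h2⟩; rw [h2]; exact G.lo _ (hs h1)
    · rintro z ⟨h1, h2⟩; rw [h2]; exact G.hi _ (hs h1)
    · rintro z ⟨h1, h2⟩; exact hM _ (hs h1)
    · rintro z ⟨h1, h2⟩ w ⟨h3, h4⟩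
      rw [h2, h4]
      rcases le_total z.re w.re with h | h
      · have := A1 _ h1 _ h3 h
        nlinarith
      · have := A1 _ h3 _ h1 h
        nlinarith
  · have hs : Icc m x2 ⊆ Icc x1 x2 := Icc_subset_Icc_left hm.1
    refine fin_mono _ a b (max |x1| |x2|) e G.ha ?_ ?_ ?_ he ?_
    · rintro z ⟨h1, h2⟩; rw [h2]; exact G.lo _ (hs h1)
    · rintro z ⟨h1, h2⟩; rw [h2]; exact G.hi _ (hs h1)
    · rintro z ⟨h1, h2⟩; exact hM _ (hs h1)
    · rintro z ⟨h1, h2⟩ w ⟨h3, h4⟩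
      rw [h2, h4]
      rcases le_total z.re w.re with h | h
      · have := A2 _ h1 _ h3 h
        nlinarith
      · have := A2 _ h3 _ h1 h
        nlinarith

lemma fin_side (c p q : ℝ) (hp : 0 < p) :
    μH[1] {z : ℍ | z.re = c ∧ p ≤ z.im ∧ z.im ≤ q} < ⊤ := by
  refine fin_mono _ p q |c| 1 hp (fun z hz => hz.2.1) (fun z hz => hz.2.2)
    (fun z hz => by rw [hz.1]) (by norm_num) ?_
  rintro z ⟨h1, -⟩ w ⟨h2, -⟩
  rw [h1, h2]; simp

lemma side_lower (c p q : ℝ) (hp : 0 < p) (hpq : p ≤ q) :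
    Real.log q - Real.log p ≤ (μH[1] {z : ℍ | z.re = c ∧ p ≤ z.im ∧ z.im ≤ q}).toReal := by
  set T := {z : ℍ | z.re = c ∧ p ≤ z.im ∧ z.im ≤ q} with hT
  have hL : LipschitzWith 1 (fun z : ℍ => Real.log z.im) :=
    LipschitzWith.of_dist_le_mul fun z w => by
      simpa using UpperHalfPlane.dist_log_im_le z w
  have h1 := (hL.lipschitzOnWith (s := T)).hausdorffMeasure_image_le (d := 1) zero_le_one
  have h2 : Icc (Real.log p) (Real.log q) ⊆ (fun z : ℍ => Real.log z.im) '' T := by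
    intro u hu
    refine ⟨⟨⟨c, Real.exp u⟩, Real.exp_pos u⟩, ⟨rfl, ?_, ?_⟩, ?_⟩
    · exact (Real.log_le_iff_le_exp hp).1 hu.1
    · exact (Real.le_log_iff_exp_le (hp.trans_le hpq)).1 hu.2
    · exact Real.log_exp u
  have h3 := (measure_mono h2).trans h1
  rw [hausdorffMeasure_real, Real.volume_Icc] at h3
  simp only [ENNReal.coe_one, ENNReal.one_rpow, one_mul] at h3
  exact (ENNReal.ofReal_le_iff_le_toReal (fin_side c p q hp).ne).1 h3

end HypIso

namespace HypIso
open Set Filter Topology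

lemma gra_mono (f : ℝ → ℝ) {S T : Set ℝ} (h : S ⊆ T) : gra f S ⊆ gra f T :=
  fun _ hz => ⟨h hz.1, hz.2⟩

lemma gra_closed {a b x1 x2 : ℝ} {f : ℝ → ℝ} (G : Gr a b x1 x2 f) :
    IsClosed (gra f (Icc x1 x2)) := by
  have h12 := G.hst.le
  have hc : Continuous (IccExtend h12 ((Icc x1 x2).domRestrict f)) :=
    (continuousOn_iff_continuous_domRestrict.1 G.cont).Icc_extend'
  have : gra f (Icc x1 x2) = UpperHalfPlane.re ⁻¹' Icc x1 x2 ∩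
      {z : ℍ | z.im = IccExtend h12 ((Icc x1 x2).domRestrict f) z.re} := by
    ext z
    simp only [gra, mem_ofPred_eq, mem_inter_iff, mem_preimage]
    refine and_congr_right fun hz => ?_
    rw [IccExtend_of_mem _ _ hz]; rfl
  rw [this]
  exact (isClosed_Icc.preimage UpperHalfPlane.continuous_re).inter
    (isClosed_eq UpperHalfPlane.continuous_im (hc.comp UpperHalfPlane.continuous_re))

lemma gra_lower {a b x1 x2 : ℝ} {f : ℝ → ℝ} (G : Gr a b x1 x2 f) {u v : ℝ}
    (hu : u ∈ Icc x1 x2) (hv : v ∈ Icc x1 x2) (huv : u ≤ v) :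
    ENNReal.ofReal (gd f u v) ≤ μH[1] (gra f (Ioc u v)) := by
  have hs : Icc u v ⊆ Icc x1 x2 := Icc_subset_Icc hu.1 hv.2
  have fpos : ∀ x ∈ Icc x1 x2, 0 < f x := fun x hx => G.ha.trans_le (G.lo x hx)
  have hL : LipschitzWith 1 (fun z : ℍ => dist z ⟨⟨u, f u⟩, fpos u hu⟩) := LipschitzWith.dist_left _
  have h1 := (hL.lipschitzOnWith (s := gra f (Ioc u v))).hausdorffMeasure_image_le
    (d := 1) zero_le_one
  rw [hausdorffMeasure_real] at h1
  simp only [ENNReal.coe_one, ENNReal.one_rpow, one_mul] at h1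
  refine le_trans ?_ h1
  have hg : ∀ x (hx : x ∈ Icc x1 x2),
      dist (⟨⟨x, f x⟩, fpos x hx⟩ : ℍ) ⟨⟨u, f u⟩, fpos u hu⟩ = gd f u x := by
    intro x hx
    rw [UpperHalfPlane.dist_eq]
    simp only [gd]
    rw [Complex.dist_eq, Complex.norm_def, Complex.normSq_apply]
    simp only [UpperHalfPlane.im, Complex.sub_re, Complex.sub_im]
    rw [mul_comm (f x) (f u), sq, sq]
  have hc : ContinuousOn (fun x => gd f u x) (Icc u v) := by
    have hf : ContinuousOn f (Icc u v) := G.cont.mono hs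
    unfold gd
    apply ContinuousOn.mul continuousOn_const
    refine Real.continuous_arsinh.comp_continuousOn ?_
    refine ContinuousOn.div ?_ ?_ ?_
    · exact ContinuousOn.sqrt (by fun_prop)
    · exact continuousOn_const.mul (ContinuousOn.sqrt (by fun_prop))
    · intro x hx
      have := mul_pos (fpos u hu) (fpos x (hs hx))
      positivity
  have h0 : gd f u u = 0 := by simp [gd]
  have hsub : Ioc 0 (gd f u v) ⊆ (fun z : ℍ => dist z ⟨⟨u, f u⟩, fpos u hu⟩) '' gra f (Ioc u v) := by
    intro r hr
    have := intermediate_value_Icc huv hc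
    rw [h0] at this
    obtain ⟨x, hx, hxr⟩ := this (Ioc_subset_Icc_self hr)
    have hxu : x ≠ u := by
      rintro rfl
      simp only [h0] at hxr
      exact hr.1.ne hxr
    refine ⟨⟨⟨x, f x⟩, fpos x (hs hx)⟩, ⟨⟨lt_of_le_of_ne hx.1 hxu.symm, hx.2⟩, rfl⟩, ?_⟩
    exact (hg x (hs hx)).trans hxr
  refine le_trans ?_ (measure_mono hsub)
  rw [Real.volume_Ioc, sub_zero]

theorem exists_dom {a b x1 x2 : ℝ} {f : ℝ → ℝ} (G : Gr a b x1 x2 f)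
    (hfin : μH[1] (gra f (Icc x1 x2)) < ⊤) :
    ∃ Λ, Dom f Λ x1 x2 ∧ Λ x2 - Λ x1 = (μH[1] (gra f (Ioo x1 x2))).toReal := by
  have hm : MeasurableSet (gra f (Icc x1 x2)) := (gra_closed G).measurableSet
  have hre : Measurable (UpperHalfPlane.re) := UpperHalfPlane.continuous_re.measurable
  have := Measure.nullSingletonClass_hausdorff ℍ (d := 1) one_pos
  let μ : Measure ℍ := (μH[1] : Measure ℍ).restrict (gra f (Icc x1 x2))
  have : IsFiniteMeasure μ := ⟨by simpa [μ] using hfin⟩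
  let ν : Measure ℝ := μ.map UpperHalfPlane.re
  have hν : IsFiniteMeasure ν := by infer_instance
  have hνS : ∀ S, MeasurableSet S → S ⊆ Icc x1 x2 → ν S = μH[1] (gra f S) := by
    intro S hS hSs
    simp only [ν, μ]
    rw [Measure.map_apply hre hS, Measure.restrict_apply (hre hS)]
    congr 1
    ext z
    simp only [gra, mem_inter_iff, mem_preimage, mem_ofPred_eq]
    constructor
    · rintro ⟨h1, -, h2⟩; exact ⟨h1, h2⟩
    · rintro ⟨h1, h2⟩; exact ⟨h1, hSs h1, h2⟩
  have hνa : NullSingletonClass ν := by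
    refine ⟨fun x => ?_⟩
    simp only [ν, μ]
    rw [Measure.map_apply hre (measurableSet_singleton x),
      Measure.restrict_apply (hre (measurableSet_singleton x))]
    apply Set.Subsingleton.measure_zero
    rintro z ⟨h1, -, h2⟩ w ⟨h3, -, h4⟩
    have e1 : z.re = w.re := by rw [h1, h3]
    exact UpperHalfPlane.ext (Complex.ext e1 (by
      change z.im = w.im
      rw [h2, h4, e1]))
  have hint : ∀ u v, IntervalIntegrable (fun _ : ℝ => (1 : ℝ)) ν u v := fun u v =>
    intervalIntegrable_const
  let Λ : ℝ → ℝ := fun x => ∫ _ in x1..x, (1 : ℝ) ∂ν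
  have hΛ : ∀ u v, u ≤ v → Λ v - Λ u = (ν (Ioc u v)).toReal := by
    intro u v huv
    simp only [Λ]
    rw [intervalIntegral.integral_interval_sub_left (hint _ _) (hint _ _),
      intervalIntegral.integral_of_le huv]
    simp [Measure.real]
  refine ⟨Λ, ⟨?_, ?_⟩, ?_⟩
  · exact (intervalIntegral.continuous_primitive hint x1).continuousOn
  · intro u hu v hv huv
    rw [hΛ u v huv]
    have hsub : Ioc u v ⊆ Icc x1 x2 := Ioc_subset_Icc_self.trans (Icc_subset_Icc hu.1 hv.2)
    apply (ENNReal.ofReal_le_iff_le_toReal (measure_ne_top _ _)).1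
    rw [hνS _ measurableSet_Ioc hsub]
    exact gra_lower G hu hv huv
  · rw [hΛ _ _ G.hst.le, ← hνS _ measurableSet_Ioo Ioo_subset_Icc_self]
    congr 1
    exact (measure_congr Ioo_ae_eq_Ioc).symm

lemma interior_dir {K : Set ℍ} {z : ℍ} (hz : z ∈ interior K) (d : ℂ) :
    ∃ e : ℝ, 0 < e ∧ ∃ w ∈ K, w.re = z.re + e * d.re ∧ w.im = z.im + e * d.im := by
  have ho : IsOpen ((fun z : ℍ => (z : ℂ)) '' interior K) :=
    UpperHalfPlane.isOpenEmbedding_coe.isOpenMap _ isOpen_interior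
  have hc : Continuous (fun e : ℝ => (z : ℂ) + e * d) := by fun_prop
  have h1 : ∀ᶠ e : ℝ in 𝓝 (0 : ℝ), (z : ℂ) + (e : ℂ) * d ∈ (fun z : ℍ => (z : ℂ)) '' interior K := by
    apply hc.continuousAt.eventually_mem
    apply ho.mem_nhds
    exact ⟨z, hz, by simp⟩
  have h2 : ∀ᶠ e : ℝ in 𝓝[>] (0 : ℝ), (z : ℂ) + (e : ℂ) * d ∈ (fun z : ℍ => (z : ℂ)) '' interior K :=
    nhdsWithin_le_nhds h1
  obtain ⟨e, ⟨w, hw, he⟩, hpos⟩ := (h2.and self_mem_nhdsWithin).exists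
  refine ⟨e, hpos, w, interior_subset hw, ?_, ?_⟩
  · have := congrArg Complex.re he
    simpa using this
  · have := congrArg Complex.im he
    simpa using this

section
variable {K : Set ℍ} {a b x1 x2 xb xt : ℝ} {f1 f2 : ℝ → ℝ}

lemma Sl.interior_sub (S : Sl K a b x1 x2 xb xt f1 f2) {z : ℍ} (hz : z ∈ interior K) :
    z.re ∈ Ioo x1 x2 ∧ f1 z.re < z.im ∧ z.im < f2 z.re := by
  have hzK := (S.mem z).1 (interior_subset hz)
  refine ⟨⟨?_, ?_⟩, ?_, ?_⟩
  · obtain ⟨e, he, w, hw, h1, h2⟩ := interior_dir hz (-1)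
    have := ((S.mem w).1 hw).1.1
    simp at h1
    linarith
  · obtain ⟨e, he, w, hw, h1, h2⟩ := interior_dir hz 1
    have := ((S.mem w).1 hw).1.2
    simp at h1
    linarith
  · obtain ⟨e, he, w, hw, h1, h2⟩ := interior_dir hz (-Complex.I)
    have := ((S.mem w).1 hw).2.1
    simp at h1 h2
    rw [h1] at this
    linarith
  · obtain ⟨e, he, w, hw, h1, h2⟩ := interior_dir hz Complex.I
    have := ((S.mem w).1 hw).2.2
    simp at h1 h2
    rw [h1] at this
    linarith

lemma Sl.sub_interior (S : Sl K a b x1 x2 xb xt f1 f2) {z : ℍ} (h : z.re ∈ Ioo x1 x2)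
    (h1 : f1 z.re < z.im) (h2 : z.im < f2 z.re) : z ∈ interior K := by
  rw [mem_interior_iff_mem_nhds]
  have hn : Icc x1 x2 ∈ 𝓝 z.re := Icc_mem_nhds h.1 h.2
  have c1 : ContinuousAt f1 z.re := S.g1.cont.continuousAt hn
  have c2 : ContinuousAt f2 z.re := S.g2.cont.continuousAt hn
  have cr : ContinuousAt UpperHalfPlane.re z := UpperHalfPlane.continuous_re.continuousAt
  have ci : ContinuousAt UpperHalfPlane.im z := UpperHalfPlane.continuous_im.continuousAt
  have d1 : ContinuousAt (fun w : ℍ => f1 w.re) z := ContinuousAt.comp (f := UpperHalfPlane.re) c1 cr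
  have d2 : ContinuousAt (fun w : ℍ => f2 w.re) z := ContinuousAt.comp (f := UpperHalfPlane.re) c2 cr
  filter_upwards [cr hn, d1.eventually_lt ci h1, ci.eventually_lt d2 h2] with w hw0 hw1 hw2
  exact (S.mem w).2 ⟨hw0, hw1.le, hw2.le⟩

/-- vertical sides -/
def side (c p q : ℝ) : Set ℍ := {z : ℍ | z.re = c ∧ p ≤ z.im ∧ z.im ≤ q}

lemma side_meas (c p q : ℝ) : MeasurableSet (side c p q) := by
  have h1 := UpperHalfPlane.continuous_re
  have h2 := UpperHalfPlane.continuous_im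
  exact ((isClosed_eq h1 continuous_const).inter ((isClosed_le continuous_const h2).inter
    (isClosed_le h2 continuous_const))).measurableSet

lemma Sl.frontier_sub (S : Sl K a b x1 x2 xb xt f1 f2) (hK : IsClosed K) :
    frontier K ⊆ (gra f1 (Icc x1 x2) ∪ gra f2 (Icc x1 x2)) ∪
      (side x1 (f1 x1) (f2 x1) ∪ side x2 (f1 x2) (f2 x2)) := by
  intro z hz
  rw [hK.frontier_eq] at hz
  obtain ⟨hzK, hzi⟩ := hz
  obtain ⟨h1, h2, h3⟩ := (S.mem z).1 hzK
  by_contra hcon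
  simp only [mem_union, not_or, gra, side, mem_ofPred_eq] at hcon
  obtain ⟨⟨n1, n2⟩, n3, n4⟩ := hcon
  apply hzi
  apply S.sub_interior
  · refine ⟨lt_of_le_of_ne h1.1 fun h => n3 ⟨h.symm, ?_, ?_⟩, lt_of_le_of_ne h1.2 fun h => n4 ⟨h, ?_, ?_⟩⟩
    all_goals first | rwa [h] | rwa [← h]
  · exact lt_of_le_of_ne h2 fun h => n1 ⟨h1, h.symm⟩
  · exact lt_of_le_of_ne h3 fun h => n2 ⟨h1, h⟩

lemma Sl.fin1 (S : Sl K a b x1 x2 xb xt f1 f2) : μH[1] (gra f1 (Icc x1 x2)) < ⊤ :=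
  fin_gra S.g1 1 (by norm_num) (by simpa using S.cv)

lemma Sl.fin2 (S : Sl K a b x1 x2 xb xt f1 f2) : μH[1] (gra f2 (Icc x1 x2)) < ⊤ :=
  fin_gra S.g2 (-1) (by norm_num) (S.cc.neg.congr fun x _ => by simp)

lemma Sl.fin (S : Sl K a b x1 x2 xb xt f1 f2) (hK : IsClosed K) : μH[1] (frontier K) < ⊤ := by
  have m1 : x1 ∈ Icc x1 x2 := left_mem_Icc.2 S.g1.hst.le
  have m2 : x2 ∈ Icc x1 x2 := right_mem_Icc.2 S.g1.hst.le
  refine (measure_mono (S.frontier_sub hK)).trans_lt ?_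
  refine (measure_union_le _ _).trans_lt (ENNReal.add_lt_top.2 ⟨?_, ?_⟩)
  · exact (measure_union_le _ _).trans_lt (ENNReal.add_lt_top.2 ⟨S.fin1, S.fin2⟩)
  · exact (measure_union_le _ _).trans_lt (ENNReal.add_lt_top.2
      ⟨fin_side _ _ _ (S.g1.ha.trans_le (S.g1.lo _ m1)),
        fin_side _ _ _ (S.g1.ha.trans_le (S.g1.lo _ m2))⟩)

theorem Sl.exists_body (S : Sl K a b x1 x2 xb xt f1 f2) (hK : IsClosed K) :
    ∃ L1 L2, Body a b x1 x2 xb xt f1 f2 L1 L2 ∧ totLen x1 x2 f1 f2 L1 L2 ≤ hypPerim K := by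
  obtain ⟨L1, D1, E1⟩ := exists_dom S.g1 S.fin1
  obtain ⟨L2, D2, E2⟩ := exists_dom S.g2 S.fin2
  refine ⟨L1, L2, ⟨S.g1, S.g2, D1, D2, S.hxb, S.hxt, S.fb, S.ft, S.ftu, S.le⟩, ?_⟩
  have m1 : x1 ∈ Icc x1 x2 := left_mem_Icc.2 S.g1.hst.le
  have m2 : x2 ∈ Icc x1 x2 := right_mem_Icc.2 S.g1.hst.le
  have p1 := S.g1.ha.trans_le (S.g1.lo _ m1)
  have p2 := S.g1.ha.trans_le (S.g1.lo _ m2)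
  have l1 := side_lower x1 (f1 x1) (f2 x1) p1 (S.le _ m1)
  have l2 := side_lower x2 (f1 x2) (f2 x2) p2 (S.le _ m2)
  change _ ≤ (μH[1] (side x1 (f1 x1) (f2 x1))).toReal at l1
  change _ ≤ (μH[1] (side x2 (f1 x2) (f2 x2))).toReal at l2
  set s1 := side x1 (f1 x1) (f2 x1) with hs1
  set s2 := side x2 (f1 x2) (f2 x2) with hs2
  set t1 := gra f1 (Ioo x1 x2) with ht1
  set t2 := gra f2 (Ioo x1 x2) with ht2
  have mo : MeasurableSet (UpperHalfPlane.re ⁻¹' Ioo x1 x2) :=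
    UpperHalfPlane.continuous_re.measurable measurableSet_Ioo
  have gm : ∀ {f : ℝ → ℝ}, Gr a b x1 x2 f → MeasurableSet (gra f (Ioo x1 x2)) := by
    intro f G
    have : gra f (Ioo x1 x2) = UpperHalfPlane.re ⁻¹' Ioo x1 x2 ∩ gra f (Icc x1 x2) := by
      ext z
      simp only [gra, mem_inter_iff, mem_preimage, mem_ofPred_eq]
      constructor
      · rintro ⟨h1, h2⟩; exact ⟨h1, Ioo_subset_Icc_self h1, h2⟩
      · rintro ⟨h1, -, h2⟩; exact ⟨h1, h2⟩
    rw [this]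
    exact mo.inter (gra_closed G).measurableSet
  have mt2 : MeasurableSet t2 := gm S.g2
  have ms1 : MeasurableSet s1 := side_meas _ _ _
  have ms2 : MeasurableSet s2 := side_meas _ _ _
  have dj1 : Disjoint t1 t2 := by
    rw [Set.disjoint_left]
    rintro z ⟨h1, h2⟩ ⟨-, h4⟩
    exact (S.lt _ h1).ne (h2.symm.trans h4)
  have dj2 : Disjoint s1 s2 := by
    rw [Set.disjoint_left]
    rintro z ⟨h1, -⟩ ⟨h2, -⟩
    exact S.g1.hst.ne (h1.symm.trans h2)
  have dj3 : Disjoint (t1 ∪ t2) (s1 ∪ s2) := by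
    rw [Set.disjoint_left]
    intro z hz hz'
    have h1 : z.re ∈ Ioo x1 x2 := by rcases hz with h | h <;> exact h.1
    rcases hz' with h | h
    · exact h1.1.ne h.1.symm
    · exact h1.2.ne h.1
  have hsub : (t1 ∪ t2) ∪ (s1 ∪ s2) ⊆ frontier K := by
    intro z hz
    rw [hK.frontier_eq]
    refine ⟨(S.mem z).2 ?_, fun hi => ?_⟩
    · rcases hz with (⟨h1, h2⟩ | ⟨h1, h2⟩) | (⟨h1, h2, h3⟩ | ⟨h1, h2, h3⟩)
      · exact ⟨Ioo_subset_Icc_self h1, h2.ge, h2.le.trans (S.lt _ h1).le⟩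
      · exact ⟨Ioo_subset_Icc_self h1, (S.lt _ h1).le.trans h2.ge, h2.le⟩
      · rw [h1]; exact ⟨m1, h2, h3⟩
      · rw [h1]; exact ⟨m2, h2, h3⟩
    · obtain ⟨i1, i2, i3⟩ := S.interior_sub hi
      rcases hz with (⟨h1, h2⟩ | ⟨h1, h2⟩) | (⟨h1, h2, h3⟩ | ⟨h1, h2, h3⟩)
      · exact i2.ne h2.symm
      · exact i3.ne h2
      · exact i1.1.ne h1.symm
      · exact i1.2.ne h1
  have hfin := S.fin hK
  have hle := measure_mono (μ := (μH[1] : Measure ℍ)) hsub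
  have hfu := hle.trans_lt hfin
  have hle' := ENNReal.toReal_mono hfin.ne hle
  rw [measure_union dj3 (ms1.union ms2), measure_union dj1 mt2, measure_union dj2 ms2] at hle' hfu
  obtain ⟨k1, k2⟩ := ENNReal.add_lt_top.1 hfu
  obtain ⟨k3, k4⟩ := ENNReal.add_lt_top.1 k1
  obtain ⟨k5, k6⟩ := ENNReal.add_lt_top.1 k2
  rw [ENNReal.toReal_add k1.ne k2.ne, ENNReal.toReal_add k3.ne k4.ne,
    ENNReal.toReal_add k5.ne k6.ne] at hle'
  unfold totLen hypPerim
  linarith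
end
end HypIso

namespace HypIso
open Set Filter Topology

lemma inner_int {p q : ℝ} (hp : 0 < p) (hpq : p ≤ q) :
    ∫⁻ y in Icc p q, ENNReal.ofReal ((y ^ 2)⁻¹) = ENNReal.ofReal (p⁻¹ - q⁻¹) := by
  have hq : 0 < q := hp.trans_le hpq
  have hne : ∀ y ∈ uIcc p q, y ≠ 0 := by
    intro y hy
    rw [uIcc_of_le hpq] at hy
    exact (hp.trans_le hy.1).ne'
  have hc : ContinuousOn (fun y : ℝ => (y ^ 2)⁻¹) (uIcc p q) := by
    apply ContinuousOn.inv₀ (by fun_prop)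
    intro y hy
    exact pow_ne_zero 2 (hne y hy)
  have hi : IntervalIntegrable (fun y : ℝ => (y ^ 2)⁻¹) volume p q := hc.intervalIntegrable
  have h1 : ∫ y in p..q, (y ^ 2)⁻¹ = p⁻¹ - q⁻¹ := by
    have := intervalIntegral.integral_eq_sub_of_hasDerivAt (a := p) (b := q)
      (f := fun y : ℝ => -y⁻¹) (f' := fun y => (y ^ 2)⁻¹) (fun y hy => by
        have := (hasDerivAt_inv (hne y hy)).fun_neg
        simpa using this) hi
    rw [this]; ring
  rw [← ofReal_integral_eq_lintegral_ofReal]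
  · rw [integral_Icc_eq_integral_Ioc, ← intervalIntegral.integral_of_le hpq, h1]
  · exact (intervalIntegrable_iff_integrableOn_Icc_of_le hpq).1 hi
  · exact Eventually.of_forall fun y => by positivity

theorem area_eq {K : Set ℍ} {x1 x2 : ℝ} {f1 f2 : ℝ → ℝ} (hK : IsClosed K) (h12 : x1 ≤ x2)
    (c1 : ContinuousOn f1 (Icc x1 x2)) (c2 : ContinuousOn f2 (Icc x1 x2))
    (pos : ∀ x ∈ Icc x1 x2, 0 < f1 x) (le : ∀ x ∈ Icc x1 x2, f1 x ≤ f2 x)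
    (mem : ∀ z : ℍ, z ∈ K ↔ z.re ∈ Icc x1 x2 ∧ f1 z.re ≤ z.im ∧ z.im ≤ f2 z.re) :
    hypArea K = ∫ x in x1..x2, ((f1 x)⁻¹ - (f2 x)⁻¹) := by
  have hme : MeasurableEmbedding (fun z : ℍ => (z : ℂ)) :=
    UpperHalfPlane.isOpenEmbedding_coe.measurableEmbedding
  let F : ℂ → ENNReal := fun w => ENNReal.ofReal ((w.im ^ 2)⁻¹)
  have hF : Measurable F := by
    have := Complex.measurable_im
    fun_prop
  let K' : Set ℂ := (fun z : ℍ => (z : ℂ)) '' K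
  have hK' : MeasurableSet K' := hme.measurableSet_image.2 hK.measurableSet
  have hmem : ∀ w : ℂ, w ∈ K' ↔ w.re ∈ Icc x1 x2 ∧ w.im ∈ Icc (f1 w.re) (f2 w.re) := by
    intro w
    constructor
    · rintro ⟨z, hz, rfl⟩
      exact (mem z).1 hz
    · rintro ⟨h1, h2⟩
      exact ⟨⟨w, (pos _ h1).trans_le h2.1⟩, (mem _).2 ⟨h1, h2⟩, rfl⟩
  have e1 : hypAreaMeasure K = ∫⁻ w, K'.indicator F w := by
    unfold hypAreaMeasure
    rw [withDensity_apply _ hK.measurableSet, ← lintegral_indicator hK.measurableSet]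
    have : ∀ z : ℍ, K.indicator (fun z : ℍ => ENNReal.ofReal ((z.im ^ 2)⁻¹)) z =
        K'.indicator F (z : ℂ) := by
      intro z
      by_cases hz : z ∈ K
      · rw [indicator_of_mem hz, indicator_of_mem (show (z : ℂ) ∈ K' from ⟨z, hz, rfl⟩)]
        rfl
      · rw [indicator_of_notMem hz, indicator_of_notMem]
        rintro ⟨w, hw, e⟩
        exact hz (UpperHalfPlane.ext e ▸ hw)
    simp_rw [this]
    rw [← hme.lintegral_map (K'.indicator F), hme.map_comap,
      ← lintegral_indicator hme.measurableSet_range]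
    congr 1
    ext w
    rw [indicator_indicator]
    congr 2
    apply inter_eq_right.2
    rintro _ ⟨z, -, rfl⟩
    exact ⟨z, rfl⟩
  have e2 : ∫⁻ w, K'.indicator F w = ∫⁻ x, ∫⁻ y, K'.indicator F (Complex.measurableEquivRealProd.symm (x, y)) := by
    have hmp := Complex.volume_preserving_equiv_real_prod.symm
    rw [← hmp.lintegral_comp (hF.indicator hK')]
    rw [Measure.volume_eq_prod, lintegral_prod]
    exact ((hF.indicator hK').comp Complex.measurableEquivRealProd.symm.measurable).aemeasurable
  have e3 : ∀ x, ∫⁻ y, K'.indicator F (Complex.measurableEquivRealProd.symm (x, y)) =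
      (Icc x1 x2).indicator (fun x => ENNReal.ofReal ((f1 x)⁻¹ - (f2 x)⁻¹)) x := by
    intro x
    by_cases hx : x ∈ Icc x1 x2
    · rw [indicator_of_mem hx, ← inner_int (pos x hx) (le x hx), ← lintegral_indicator measurableSet_Icc]
      congr 1
      ext y
      by_cases hy : y ∈ Icc (f1 x) (f2 x)
      · rw [indicator_of_mem hy, indicator_of_mem ((hmem _).2 ⟨hx, hy⟩)]
        rfl
      · rw [indicator_of_notMem hy, indicator_of_notMem]
        intro h
        exact hy ((hmem _).1 h).2
    · rw [indicator_of_notMem hx]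
      rw [lintegral_eq_zero_of_ae_eq_zero]
      refine Eventually.of_forall fun y => ?_
      exact indicator_of_notMem (fun h => hx ((hmem _).1 h).1) _
  have cc : ContinuousOn (fun x => (f1 x)⁻¹ - (f2 x)⁻¹) (Icc x1 x2) :=
    (c1.inv₀ fun x hx => (pos x hx).ne').sub
      (c2.inv₀ fun x hx => ((pos x hx).trans_le (le x hx)).ne')
  have hnn : ∀ x ∈ Icc x1 x2, 0 ≤ (f1 x)⁻¹ - (f2 x)⁻¹ := fun x hx =>
    sub_nonneg.2 (inv_anti₀ (pos x hx) (le x hx))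
  unfold hypArea
  rw [e1, e2]
  simp_rw [e3]
  rw [lintegral_indicator measurableSet_Icc, ← ofReal_integral_eq_lintegral_ofReal,
    ENNReal.toReal_ofReal, integral_Icc_eq_integral_Ioc, ← intervalIntegral.integral_of_le h12]
  · exact setIntegral_nonneg measurableSet_Icc hnn
  · exact cc.integrableOn_Icc
  · exact (ae_restrict_iff' measurableSet_Icc).2 (Eventually.of_forall hnn)

end HypIso

namespace HypIso
open Set Filter Topology

lemma mem_closedBall_iff (z z0 : ℍ) (r : ℝ) (hr : 0 < r) :
    z ∈ Metric.closedBall z0 r ↔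
      (z.re - z0.re) ^ 2 + (z.im - z0.im * Real.cosh r) ^ 2 ≤ (z0.im * Real.sinh r) ^ 2 := by
  have hs : 0 ≤ z0.im * Real.sinh r := mul_nonneg z0.im_pos.le (Real.sinh_nonneg_iff.2 hr.le)
  rw [Metric.mem_closedBall, UpperHalfPlane.dist_le_iff_dist_coe_center_le,
    ← sq_le_sq₀ dist_nonneg hs, Complex.dist_eq, ← Complex.normSq_eq_norm_sq, Complex.normSq_apply]
  simp only [Complex.sub_re, Complex.sub_im, UpperHalfPlane.coe_re, UpperHalfPlane.coe_im,
    UpperHalfPlane.center_re, UpperHalfPlane.center_im, ← sq]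

lemma mem_sphere_iff (z z0 : ℍ) (r : ℝ) (hr : 0 < r) :
    z ∈ Metric.sphere z0 r ↔
      (z.re - z0.re) ^ 2 + (z.im - z0.im * Real.cosh r) ^ 2 = (z0.im * Real.sinh r) ^ 2 := by
  have hs : 0 ≤ z0.im * Real.sinh r := mul_nonneg z0.im_pos.le (Real.sinh_nonneg_iff.2 hr.le)
  rw [Metric.mem_sphere, UpperHalfPlane.dist_eq_iff_dist_coe_center_eq,
    ← sq_eq_sq₀ dist_nonneg hs, Complex.dist_eq, ← Complex.normSq_eq_norm_sq, Complex.normSq_apply]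
  simp only [Complex.sub_re, Complex.sub_im, UpperHalfPlane.coe_re, UpperHalfPlane.coe_im,
    UpperHalfPlane.center_re, UpperHalfPlane.center_im, ← sq]

lemma disc_region {x y x0 c ρ : ℝ} (hρ : 0 < ρ) :
    (x - x0) ^ 2 + (y - c) ^ 2 ≤ ρ ^ 2 ↔ x ∈ Icc (x0 - ρ) (x0 + ρ) ∧
      c - √(ρ ^ 2 - (x - x0) ^ 2) ≤ y ∧ y ≤ c + √(ρ ^ 2 - (x - x0) ^ 2) := by
  constructor
  · intro h
    have h1 : |x - x0| ≤ ρ := abs_le_of_sq_le_sq (by nlinarith [sq_nonneg (y - c)]) hρ.le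
    have h2 : |y - c| ≤ √(ρ ^ 2 - (x - x0) ^ 2) := Real.abs_le_sqrt (by linarith)
    rw [abs_le] at h1 h2
    refine ⟨⟨by linarith, by linarith⟩, by linarith, by linarith⟩
  · rintro ⟨⟨h1, h2⟩, h3, h4⟩
    have hp : 0 ≤ ρ ^ 2 - (x - x0) ^ 2 := by nlinarith
    have h5 : (y - c) ^ 2 ≤ √(ρ ^ 2 - (x - x0) ^ 2) ^ 2 := sq_le_sq' (by linarith) (by linarith)
    rw [Real.sq_sqrt hp] at h5
    linarith

theorem disc_area (z0 : ℍ) (r : ℝ) (hr : 0 < r) :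
    hypArea (Metric.closedBall z0 r) = 2 * Real.pi * (Real.cosh r - 1) := by
  have hy := z0.im_pos
  have hsp : 0 < Real.sinh r := Real.sinh_pos_iff.2 hr
  have hcs := Real.cosh_sq r
  have hlt : Real.sinh r < Real.cosh r := Real.sinh_lt_cosh r
  set c := z0.im * Real.cosh r with hc
  set ρ := z0.im * Real.sinh r with hρd
  have hρ : 0 < ρ := mul_pos hy hsp
  have hρc : ρ < c := mul_lt_mul_of_pos_left hlt hy
  have hsq : √(c ^ 2 - ρ ^ 2) = z0.im := by
    rw [show c ^ 2 - ρ ^ 2 = z0.im ^ 2 by rw [hc, hρd]; linear_combination z0.im ^ 2 * hcs]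
    exact Real.sqrt_sq hy.le
  have hmem : ∀ z : ℍ, z ∈ Metric.closedBall z0 r ↔ z.re ∈ Icc (z0.re - ρ) (z0.re + ρ) ∧
      c - √(ρ ^ 2 - (z.re - z0.re) ^ 2) ≤ z.im ∧ z.im ≤ c + √(ρ ^ 2 - (z.re - z0.re) ^ 2) := by
    intro z
    rw [mem_closedBall_iff _ _ _ hr]
    exact disc_region hρ
  have hle : ∀ x, √(ρ ^ 2 - (x - z0.re) ^ 2) ≤ ρ := by
    intro x
    rw [Real.sqrt_le_left hρ.le]
    nlinarith [sq_nonneg (x - z0.re)]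
  rw [area_eq (f1 := fun x => c - √(ρ ^ 2 - (x - z0.re) ^ 2))
    (f2 := fun x => c + √(ρ ^ 2 - (x - z0.re) ^ 2)) Metric.isClosed_closedBall (by linarith)
    (by fun_prop) (by fun_prop) (fun x _ => by linarith [hle x])
    (fun x _ => by linarith [Real.sqrt_nonneg (ρ ^ 2 - (x - z0.re) ^ 2)]) hmem]
  have h := intervalIntegral.integral_comp_sub_right (a := z0.re - ρ) (b := z0.re + ρ)
    (fun x => (c - √(ρ ^ 2 - x ^ 2))⁻¹ - (c + √(ρ ^ 2 - x ^ 2))⁻¹) z0.re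
  rw [h, show z0.re - ρ - z0.re = -ρ by ring, show z0.re + ρ - z0.re = ρ by ring,
    disc_int hρ hρc, hsq, hc]
  field_simp

theorem disc_perim (z0 : ℍ) (r : ℝ) (hr : 0 < r) :
    hypPerim (Metric.closedBall z0 r) ≤ 2 * Real.pi * Real.sinh r := by
  have hy := z0.im_pos
  have hsp : 0 < Real.sinh r := Real.sinh_pos_iff.2 hr
  have hcs := Real.cosh_sq r
  have hlt : Real.sinh r < Real.cosh r := Real.sinh_lt_cosh r
  set S := Real.sinh r with hS
  set C := Real.cosh r with hC
  set x0 := z0.re with hx0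
  set y0 := z0.im with hy0
  have hD : ∀ θ, 0 < C - S * Real.cos θ := by
    intro θ
    have := mul_le_mul_of_nonneg_left (Real.cos_le_one θ) hsp.le
    linarith
  let γ : ℝ → ℍ := fun θ => ⟨⟨x0 + y0 * S * Real.sin θ / (C - S * Real.cos θ),
    y0 / (C - S * Real.cos θ)⟩, div_pos hy (hD θ)⟩
  have hre : ∀ θ, (γ θ).re = x0 + y0 * S * Real.sin θ / (C - S * Real.cos θ) := fun _ => rfl
  have him : ∀ θ, (γ θ).im = y0 / (C - S * Real.cos θ) := fun _ => rfl
  have hL : LipschitzWith ⟨S, hsp.le⟩ γ := by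
    apply LipschitzWith.of_dist_le_mul
    intro θ φ
    change dist (γ θ) (γ φ) ≤ S * dist θ φ
    refine (UpperHalfPlane.dist_le_dist_coe_div_sqrt _ _).trans ?_
    have hp : 0 < (γ θ).im * (γ φ).im := mul_pos (γ θ).im_pos (γ φ).im_pos
    rw [div_le_iff₀ (Real.sqrt_pos.2 hp)]
    rw [← sq_le_sq₀ dist_nonneg (by positivity), Complex.dist_eq, ← Complex.normSq_eq_norm_sq,
      Complex.normSq_apply, mul_pow, Real.sq_sqrt hp.le, mul_pow, Real.dist_eq, sq_abs]
    simp only [Complex.sub_re, Complex.sub_im, UpperHalfPlane.coe_re, UpperHalfPlane.coe_im,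
      hre, him]
    have h1 := hD θ
    have h2 := hD φ
    have hcos := Real.one_sub_sq_div_two_le_cos (x := θ - φ)
    rw [Real.cos_sub] at hcos
    have t1 := Real.sin_sq_add_cos_sq θ
    have t2 := Real.sin_sq_add_cos_sq φ
    set s1 := Real.sin θ
    set c1 := Real.cos θ
    set s2 := Real.sin φ
    set c2 := Real.cos φ
    have key : (s1 * (C - S * c2) - s2 * (C - S * c1)) ^ 2 + (c1 - c2) ^ 2 =
        (C - S * c1) * (C - S * c2) * (2 - 2 * (c1 * c2 + s1 * s2)) := by
      linear_combination (C - S * c2) ^ 2 * t1 + (C - S * c1) ^ 2 * t2 - (c1 - c2) ^ 2 * hcs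
    have e : (x0 + y0 * S * s1 / (C - S * c1) - (x0 + y0 * S * s2 / (C - S * c2))) *
        (x0 + y0 * S * s1 / (C - S * c1) - (x0 + y0 * S * s2 / (C - S * c2))) +
        (y0 / (C - S * c1) - y0 / (C - S * c2)) * (y0 / (C - S * c1) - y0 / (C - S * c2)) =
        y0 ^ 2 * S ^ 2 / ((C - S * c1) * (C - S * c2)) ^ 2 *
        ((s1 * (C - S * c2) - s2 * (C - S * c1)) ^ 2 + (c1 - c2) ^ 2) := by
      field_simp
      ring
    rw [e, key]
    have e2 : y0 ^ 2 * S ^ 2 / ((C - S * c1) * (C - S * c2)) ^ 2 *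
        ((C - S * c1) * (C - S * c2) * (2 - 2 * (c1 * c2 + s1 * s2))) =
        S ^ 2 * (2 - 2 * (c1 * c2 + s1 * s2)) * (y0 / (C - S * c1) * (y0 / (C - S * c2))) := by
      field_simp
    rw [e2]
    apply mul_le_mul_of_nonneg_right _ (by positivity)
    apply mul_le_mul_of_nonneg_left _ (by positivity)
    linarith
  have hsub : frontier (Metric.closedBall z0 r) ⊆ γ '' Icc (-Real.pi) Real.pi := by
    refine Metric.frontier_closedBall_subset_sphere.trans ?_
    intro z hz
    have h := (mem_sphere_iff z z0 r hr).1 hz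
    have hzp := z.im_pos
    let w : ℂ := ⟨(C - y0 / z.im) / S, (z.re - x0) / (z.im * S)⟩
    have hw : ‖w‖ = 1 := by
      rw [Complex.norm_def, Real.sqrt_eq_one, Complex.normSq_apply]
      simp only [w]
      field_simp
      linear_combination h + (z.im ^ 2 - y0 ^ 2) * hcs
    have hc := Complex.norm_mul_cos_arg w
    have hs := Complex.norm_mul_sin_arg w
    rw [hw, one_mul] at hc hs
    simp only [w] at hc hs
    refine ⟨Complex.arg w, ⟨(Complex.neg_pi_lt_arg w).le, Complex.arg_le_pi w⟩, ?_⟩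
    have d : C - S * Real.cos (Complex.arg w) = y0 / z.im := by
      change C - S * Real.cos (Complex.arg ⟨(C - y0 / z.im) / S, (z.re - x0) / (z.im * S)⟩) = _
      rw [hc]; field_simp; ring
    have i1 : (γ (Complex.arg w)).im = z.im := by
      rw [him, d]; field_simp
    have r1 : (γ (Complex.arg w)).re = z.re := by
      rw [hre, d]
      change x0 + y0 * S * Real.sin (Complex.arg ⟨(C - y0 / z.im) / S, (z.re - x0) / (z.im * S)⟩) / _ = _
      rw [hs]; field_simp; ring
    exact UpperHalfPlane.ext (Complex.ext r1 i1)
  have h1 := hL.hausdorffMeasure_image_le (d := 1) zero_le_one (Icc (-Real.pi) Real.pi)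
  have h2 := (measure_mono hsub).trans h1
  rw [hausdorffMeasure_real, Real.volume_Icc, ENNReal.rpow_one] at h2
  unfold hypPerim
  refine ENNReal.toReal_le_of_le_ofReal (by positivity) (h2.trans (le_of_eq ?_))
  have : ENNReal.ofNNReal ⟨S, hsp.le⟩ = ENNReal.ofReal S := by
    rw [ENNReal.ofReal]
    congr 1
    exact (Real.toNNReal_of_nonneg hsp.le).symm
  rw [this, ← ENNReal.ofReal_mul hsp.le]
  congr 1
  ring

end HypIso

namespace HypIso
open Set Filter Topology

theorem main_aux (K : Set ℍ)
    (hKcomp : IsCompact K) (hKconv : HypConvex K) (hKint : (interior K).Nonempty) :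
    hypArea K * (4 * Real.pi + hypArea K) ≤ hypPerim K ^ 2 ∧
    (hypPerim K ^ 2 = hypArea K * (4 * Real.pi + hypArea K) → IsHypDisc K) := by
  obtain ⟨a, b, x1, x2, xb, xt, f1, f2, S⟩ := exists_sl K hKcomp hKconv hKint
  have hKc := hKcomp.isClosed
  obtain ⟨L1, L2, B, hP⟩ := S.exists_body hKc
  have hA := area_eq hKc S.g1.hst.le S.g1.cont S.g2.cont
    (fun x hx => S.g1.ha.trans_le (S.g1.lo x hx)) S.le S.mem
  have hI := B.ineq
  have hR := B.rigid
  rw [← hA] at hI hR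
  have ha := S.g1.ha
  have hab := S.g1.hab
  have hA0 : 0 ≤ hypArea K := ENNReal.toReal_nonneg
  have hP0 : 0 ≤ hypPerim K := ENNReal.toReal_nonneg
  set A := hypArea K
  set P := hypPerim K
  set L := totLen x1 x2 f1 f2 L1 L2
  set c := (a + b) / 2 with hc
  set ρ := (b - a) / 2 with hρd
  set g := √(a * b) with hg
  have hρ : 0 < ρ := by rw [hρd]; linarith
  have hcp : 0 < c := by rw [hc]; linarith
  have habp : 0 < a * b := mul_pos ha (ha.trans hab)
  have hgp : 0 < g := Real.sqrt_pos.2 habp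
  have hg2 : g ^ 2 = c ^ 2 - ρ ^ 2 := by
    rw [hg, Real.sq_sqrt habp.le, hc, hρd]; ring
  have hpi := Real.pi_pos
  have hLP : ρ * L ≤ ρ * P := mul_le_mul_of_nonneg_left hP hρ.le
  have h1 : c * (A + 2 * Real.pi) ≤ ρ * P + 2 * Real.pi * g := by linarith
  have h2 : (c * (A + 2 * Real.pi)) ^ 2 ≤ (ρ * P + 2 * Real.pi * g) ^ 2 :=
    pow_le_pow_left₀ (by positivity) h1 2
  have h3 : (ρ * P + 2 * Real.pi * g) ^ 2 ≤ c ^ 2 * (P ^ 2 + (2 * Real.pi) ^ 2) := by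
    have e : c ^ 2 * (P ^ 2 + (2 * Real.pi) ^ 2) =
      (ρ * P + 2 * Real.pi * g) ^ 2 + (ρ * (2 * Real.pi) - g * P) ^ 2 := by
      linear_combination (-(P ^ 2 + (2 * Real.pi) ^ 2)) * hg2
    rw [e]
    nlinarith [sq_nonneg (ρ * (2 * Real.pi) - g * P)]
  refine ⟨?_, fun hE => ?_⟩
  · have h4 : c ^ 2 * (A + 2 * Real.pi) ^ 2 ≤ c ^ 2 * (P ^ 2 + (2 * Real.pi) ^ 2) := by
      rw [← mul_pow]; exact h2.trans h3
    have h5 := le_of_mul_le_mul_left h4 (by positivity)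
    nlinarith
  · have h4 : (ρ * P + 2 * Real.pi * g) ^ 2 ≤ (c * (A + 2 * Real.pi)) ^ 2 := by
      refine h3.trans (le_of_eq ?_)
      rw [hE]; ring
    have h5 : ρ * P + 2 * Real.pi * g ≤ c * (A + 2 * Real.pi) :=
      (sq_le_sq₀ (by positivity) (by positivity)).1 h4
    obtain ⟨r1, r2, r3⟩ := hR (by linarith)
    have hsinh : Real.sinh (Real.arsinh (ρ / g)) = ρ / g := Real.sinh_arsinh _
    have hrp : 0 < Real.arsinh (ρ / g) := Real.arsinh_pos_iff.2 (by positivity)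
    have hcosh : Real.cosh (Real.arsinh (ρ / g)) = c / g := by
      rw [← sq_eq_sq₀ (Real.cosh_pos _).le (by positivity), Real.cosh_sq, hsinh]
      field_simp
      linarith
    refine ⟨⟨⟨xt, g⟩, hgp⟩, Real.arsinh (ρ / g), hrp, ?_⟩
    ext z
    rw [mem_closedBall_iff _ _ _ hrp, hsinh, hcosh, S.mem]
    change _ ↔ (z.re - xt) ^ 2 + (z.im - g * (c / g)) ^ 2 ≤ (g * (ρ / g)) ^ 2
    rw [mul_div_cancel₀ _ hgp.ne', mul_div_cancel₀ _ hgp.ne', disc_region hρ, r1, r2]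
    refine and_congr_right fun hz => ?_
    rw [← r1, ← r2] at hz
    obtain ⟨q1, q2, q3, q4⟩ := r3 _ hz
    have e1 : f1 z.re = c - √(ρ ^ 2 - (z.re - xt) ^ 2) := by
      have : √(ρ ^ 2 - (z.re - xt) ^ 2) = c - f1 z.re := by
        rw [show ρ ^ 2 - (z.re - xt) ^ 2 = (c - f1 z.re) ^ 2 by linear_combination -q3]
        exact Real.sqrt_sq (by linarith)
      linarith
    have e2 : f2 z.re = c + √(ρ ^ 2 - (z.re - xt) ^ 2) := by
      have : √(ρ ^ 2 - (z.re - xt) ^ 2) = f2 z.re - c := by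
        rw [show ρ ^ 2 - (z.re - xt) ^ 2 = (f2 z.re - c) ^ 2 by linear_combination -q4]
        exact Real.sqrt_sq (by linarith)
      linarith
    rw [e1, e2]

theorem main_disc (z0 : ℍ) (r : ℝ) (hr : 0 < r) :
    hypPerim (Metric.closedBall z0 r) ^ 2 ≤ hypArea (Metric.closedBall z0 r) *
      (4 * Real.pi + hypArea (Metric.closedBall z0 r)) := by
  have h1 := disc_perim z0 r hr
  rw [disc_area z0 r hr]
  have hP0 : 0 ≤ hypPerim (Metric.closedBall z0 r) := ENNReal.toReal_nonneg
  have h2 := pow_le_pow_left₀ hP0 h1 2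
  refine h2.trans (le_of_eq ?_)
  linear_combination (-(4 * Real.pi ^ 2)) * Real.cosh_sq r

end HypIso

/-- Isoperimetric inequality for the hyperbolic plane `H²`:
`P_K² ≥ A_K(4π + A_K)`, with equality iff `K` is a closed hyperbolic disc. -/
theorem isoperimetric_inequality_hyperbolic (K : Set ℍ)
    (hKcomp : IsCompact K) (hKconv : HypConvex K) (hKint : (interior K).Nonempty) :
    hypPerim K ^ 2 ≥ hypArea K * (4 * π + hypArea K) ∧
    (hypPerim K ^ 2 = hypArea K * (4 * π + hypArea K) ↔ IsHypDisc K) := by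
  obtain ⟨h1, h2⟩ := HypIso.main_aux K hKcomp hKconv hKint
  refine ⟨h1, h2, ?_⟩
  rintro ⟨z0, r, hr, rfl⟩
  exact le_antisymm (HypIso.main_disc z0 r hr) h1
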